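/- If Γ is a graph of girth at least 5 on 25 vertices with 57 edges, then (δ(Γ), Δ(Γ)) is one of (3,5), (4,5), (4,6). If (δ(Γ), Δ(Γ)) = (3,5) or (4,5), then Γ has an embedded S_{5,[4,4,4,4,3]} star or an embedded S_{5,[4,4,4,3,3]} star (a vertex of degree 5 with four, respectively three, neighbours of degree at least 5 and all remaining neighbours of degree at least 4). If (δ(Γ), Δ(Γ)) = (4,6), then the number of vertices of degree 6 is 1 or 2, and Γ has an embedded S_{6,[3,3,3,3,3,3]} star (a vertex of degree 6 all of whose neighbours have degree at least 4). -/

import Mathlib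

open SimpleGraph

/-- `Γ` has girth at least 5: every cycle has length at least 5. -/
def GirthAtLeast5 {V : Type*} (G : SimpleGraph V) : Prop :=
  ∀ ⦃u : V⦄ (w : G.Walk u u), w.IsCycle → 5 ≤ w.length

/-- `G` has an embedded `S_{D,[e 0, …, e (D-1)]}` star: a vertex `x` of degree `D`
whose `D` neighbours can be enumerated as `y 0, …, y (D-1)` with
`deg (y i) ≥ e i + 1` for each `i`. -/
def HasEmbeddedStar {V : Type*} [Fintype V] (G : SimpleGraph V) [DecidableRel G.Adj]
    (D : ℕ) (e : Fin D → ℕ) : Prop :=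
  ∃ (x : V) (y : Fin D → V), G.degree x = D ∧ Function.Injective y ∧
    (∀ i, G.Adj x (y i)) ∧ ∀ i, e i + 1 ≤ G.degree (y i)

/-- `deg_i`: the number of vertices of `G` of degree `i`. -/
def degCount {V : Type*} [Fintype V] (G : SimpleGraph V) [DecidableRel G.Adj] (i : ℕ) : ℕ :=
  (Finset.univ.filter fun x => G.degree x = i).card

set_option linter.all false
namespace TS
noncomputable section
/-- evaluate a natural number before continuing -/
def frc (x : Nat) (k : Nat → Bool) : Bool := Nat.rec (k 0) (fun m _ => k (Nat.succ m)) x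
/-- the same with a hash in the low bits -/
def frcS (x : Nat) (k : Nat → Bool) : Bool :=
  frc (Nat.add (Nat.mul x 18446744073709551616) (Nat.mod x 18446744073709551557)) fun s => k (Nat.div s 18446744073709551616)
def ife (b x y : Bool) : Bool := Bool.rec y x b
def ifn (b : Bool) (x y : Nat) : Nat := Bool.rec y x b

def bt (i : Nat) : Nat := Nat.shiftLeft 1 i
def bf (i : Nat) : Nat := Nat.shiftLeft 1 (Nat.mul 32 i)
def row (X i : Nat) : Nat := Nat.land (Nat.shiftRight X (Nat.mul 32 i)) 4294967295
def tl (x : Nat) : Nat := Nat.land x (Nat.sub x 1)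
def lb (x : Nat) : Nat := Nat.xor x (tl x)
/-- index of the lowest bit of a row -/
def ix (x : Nat) : Nat := Nat.land (Nat.shiftRight 1927099591673202653400830979024622892061803801320520572166761615360 (Nat.mul 6 (Nat.mod (lb x) 37))) 63
/-- index of the lowest field of a column -/
def ixc (x : Nat) : Nat := Nat.land (Nat.shiftRight 89589798765187832286566372894018462112726986509350746160788515170762602607309288216828488623587698933760 (Nat.mul 6 (Nat.mod (lb x) 59))) 63

def pcl (fuel : Nat) : Nat → Nat :=
  Nat.rec (fun _ => 0) (fun _ ih x => ifn (Nat.beq x 0) 0 (Nat.succ (ih (tl x)))) fuel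

structure Cfg where
  R : Nat
  pri : List Nat
  col : Nat
  allr : Nat
  m31 : Nat
  all : Nat
  offd : Nat
  D : Nat
  M : Nat
  Mc : Nat
  K : Nat
  c5 : Nat
  c3 : Nat
  cf : Nat
  c63 : Nat
  c64 : Nat

/-- nonzero fields -/
def nz (c : Cfg) (x : Nat) : Nat := Nat.land (Nat.shiftRight (Nat.add x c.m31) 31) c.col
/-- column to row -/
def c2r (x : Nat) : Nat := Nat.mod x 2147483647

def spc1 (c : Cfg) (x : Nat) : Nat := Nat.sub x (Nat.land (Nat.shiftRight x 1) c.c5)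
def spc2 (c : Cfg) (x : Nat) : Nat := Nat.add (Nat.land x c.c3) (Nat.land (Nat.shiftRight x 2) c.c3)
def spc3 (c : Cfg) (x : Nat) : Nat := Nat.land (Nat.add x (Nat.shiftRight x 4)) c.cf
def spc4 (x : Nat) : Nat := Nat.add x (Nat.shiftRight x 8)
def spc5 (c : Cfg) (x : Nat) : Nat := Nat.land (Nat.add x (Nat.shiftRight x 16)) c.c63
def spc (c : Cfg) (x : Nat) : Nat := spc5 c (spc4 (spc3 c (spc2 c (spc1 c x))))

def groups (c : Cfg) (E A : Nat) : Nat → Nat → Nat :=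
  Nat.rec (fun _ acc => acc) (fun _ ih t acc =>
    ifn (Nat.beq t 0) acc
    (ih (tl t) (Nat.add acc (nz c (Nat.land A (Nat.mul c.col (row E (ix t)))))))) 8

def scan (c : Cfg) (X cand : Nat) (k : Nat → Nat → Nat) : Nat → Nat :=
  Nat.rec (fun _ => 0) (fun _ ih t =>
    (fun z => ifn (Nat.beq z 0) (ih (Nat.succ t)) (k t z))
    (Nat.land (Nat.shiftRight (Nat.sub (Nat.mul c.col (Nat.add 2147483648 t)) X) 31) cand)) 40

def ming (E a : Nat) : Nat → Nat → Nat → Nat :=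
  Nat.rec (fun _ _ rest => ix rest) (fun _ ih t bst rest =>
    ifn (Nat.beq t 0) (ix rest)
    ((fun h => (fun p => ifn (Nat.beq p 0) (ih (tl t) bst rest) (ifn (Nat.ble bst p) (ih (tl t) bst rest) (ih (tl t) p h)))
      (pcl 12 h)) (Nat.land a (row E (ix t))))) 8

/-- cover test: at most `fuel` further neighbours -/
def cover (E r u : Nat) (fuel : Nat) : Nat → Bool :=
  Nat.rec (fun X => Nat.beq X 0) (fun _ ih X => ife (Nat.beq X 0) true
    ((fun i => (fun t => (fun y => 
       ih (Nat.xor X (Nat.land X (ifn (Nat.beq t 0) (bt i) (ifn (Nat.beq y u) (bt i) (row E y))))))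
      (ix t)) (Nat.land (row E i) r)) (ix X))) fuel

def sub (A X : Nat) : Nat := Nat.xor A (Nat.land A X)
def capD (c : Cfg) (E z A : Nat) : Nat :=
  ifn (Nat.ble (row c.D z) (pcl 12 (row E z)))
    (sub A (Nat.lor (Nat.shiftLeft c.allr (Nat.mul 32 z)) (Nat.shiftLeft c.col z))) A
def capK (c : Cfg) (E z A : Nat) : Nat :=
  ifn (Nat.ble (row c.K z) (pcl 12 (Nat.land (row E z) c.M)))
    (sub A (Nat.lor (Nat.shiftLeft c.M (Nat.mul 32 z)) (Nat.shiftLeft c.Mc z))) A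
def capz (c : Cfg) (E z A : Nat) : Nat := capK c E z (capD c E z A)

/-- pairs killed by the edge uv: half of them -/
def kill (c : Cfg) (E u v A1 : Nat) (b1 : Nat) : Nat :=
  (fun a2 => Nat.lor (Nat.shiftLeft (Nat.lor (Nat.lor A1 (c2r a2)) (bt u)) (Nat.mul 32 v))
   (Nat.lor (Nat.mul b1 (Nat.lor A1 (bt u))) (Nat.shiftLeft a2 v))) (nz c (Nat.land E (Nat.mul c.col A1)))
def getc (c : Cfg) (E u : Nat) : Nat := Nat.land (Nat.shiftRight E u) c.col
def addE (E u v : Nat) : Nat := Nat.lor E (Nat.lor (bt (Nat.add (Nat.mul 32 u) v)) (bt (Nat.add (Nat.mul 32 v) u)))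
def addA (c : Cfg) (E E1 A u v : Nat) : Nat :=
  capz c E1 v (capz c E1 u (sub A (Nat.lor (kill c E u v (row E u) (getc c E v)) (kill c E v u (row E v) (getc c E u)))))

/-- column of vertices with the same row as v off the diagonal and column v -/
def twins (c : Cfg) (E A u v : Nat) : Nat :=
  Nat.land (Nat.land (Nat.shiftRight A u) c.col)
   (Nat.xor c.col (nz c (Nat.land (Nat.lor (Nat.xor E (Nat.mul c.col (row E v))) (Nat.xor A (Nat.mul c.col (row A v))))
     (sub c.offd (Nat.shiftLeft c.col v)))))
def forbT (c : Cfg) (E A u v : Nat) : Nat :=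
  (fun t => sub A (Nat.lor (Nat.shiftLeft t u) (Nat.shiftLeft (c2r t) (Nat.mul 32 u)))) (twins c E A u v)

def prio (ND : Nat) (d : Nat) : List Nat → Nat :=
  List.rec d (fun u _ ih => ifn (Nat.beq (row ND u) 0) ih u)

/-- vertex to branch on; 64 + vertex if it cannot be completed -/
def pickU (c : Cfg) (E AV U ND : Nat) : Nat :=
  prio ND
  (scan c (Nat.sub (Nat.add (Nat.add (groups c E AV (row E c.R) 0) (spc c (sub AV (Nat.mul c.col U)))) c.c64) ND) (nz c ND)
    (fun t z => ifn (Nat.beq t 63) (Nat.add 64 (ixc z)) (scan c (spc c AV) z (fun _ z => ixc z) 1)) 63) c.pri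
def pickV (E r a U : Nat) : Nat := 
  (fun rr => ifn (Nat.beq rr 0) (ming E a r 99 0) (ix rr)) (sub a U)

def search (c : Cfg) (fuel : Nat) : Nat → Nat → Bool :=
  Nat.rec (fun _ _ => false) (fun _ ih E A =>
    (fun AV U ND => 
    frc (pickU c E AV U ND) fun u0 =>
    frc (Nat.land u0 63) fun u =>
    frc (row AV u) fun a =>
    ife (ife (Nat.ble 64 u0) true (Nat.beq a 0))
      (Nat.rec false (fun d _ => cover E (row E c.R) u d (Nat.lor (row E u) a)) (row c.D u))
      (frc (pickV E (row E c.R) a U) fun v =>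
       ife (Nat.beq (Nat.land (sub a (bt u)) (bt v)) 0) false
       (ife (frcS (addE E u v) fun E1 => frcS (addA c E E1 A u v) fun A1 => ih E1 A1)
         (frcS (forbT c E A u v) fun A' => ih E A') false)))
     (Nat.land A c.all) (c2r (nz c (Nat.land E (Nat.mul c.col (row E c.R))))) (Nat.sub c.D (spc c E))) fuel

def initE (c : Cfg) (k : Nat → Nat → Bool) : List (Nat × Nat) → Nat → Nat → Bool :=
  List.rec (fun E A => k E A) (fun p _ ih E A =>
    frcS (addE E p.1 p.2) fun E1 => frcS (addA c E E1 A p.1 p.2) fun A1 => ih E1 A1)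

def pack (l : List Nat) : Nat := List.rec 0 (fun a _ ih => Nat.add a (Nat.mul 4294967296 ih)) l
def rep (n a : Nat) : Nat := Nat.rec 0 (fun _ ih => Nat.add a (Nat.mul 4294967296 ih)) n
def diag (n : Nat) : Nat := Nat.rec 0 (fun m ih => Nat.lor ih (bt (Nat.mul 33 m))) n
def bitsOf (l : List Nat) : Nat := List.rec 0 (fun a _ ih => Nat.lor (bt a) ih) l
def colOf (l : List Nat) : Nat := List.rec 0 (fun a _ ih => Nat.lor (bf a) ih) l

def mkCfg (n R : Nat) (pri D M K : List Nat) : Cfg :=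
  ⟨R, pri, rep n 1, Nat.pred (bt n), Nat.mul (rep n 1) 2147483647, Nat.mul (rep n 1) (Nat.pred (bt n)),
   sub (Nat.mul (rep n 1) 2147483647) (diag n), pack D, bitsOf M, colOf M, pack K,
   Nat.mul (rep n 1) 1431655765, Nat.mul (rep n 1) 858993459, Nat.mul (rep n 1) 252645135, Nat.mul (rep n 1) 63, Nat.mul (rep n 1) 64⟩
/-- cls : class labels < 32 -/
def run (c : Cfg) (n : Nat) (cls : Nat) (ed : List (Nat × Nat)) : Bool :=
  initE c (search c 200) ed 0 (Nat.lor (sub c.all (diag n)) (Nat.shiftLeft cls 26))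
end
end TS

namespace TS
theorem frc_eq (x : ℕ) (k : ℕ → Bool) : frc x k = k x := by cases x <;> rfl
theorem frcS_eq (x : ℕ) (k : ℕ → Bool) : frcS x k = k x := by
  unfold frcS
  rw [frc_eq]
  congr 1
  show (x * 18446744073709551616 + x % 18446744073709551557) / 18446744073709551616 = x
  omega
theorem ife_eq (b x y : Bool) : ife b x y = if b then x else y := by cases b <;> rfl
theorem ifn_eq (b : Bool) (x y : ℕ) : ifn b x y = if b then x else y := by cases b <;> rfl

theorem tb_row (X i j : ℕ) : (row X i).testBit j = (decide (j < 32) && X.testBit (32 * i + j)) := by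
  show ((X >>> (32 * i)) &&& 4294967295).testBit j = _
  rw [Nat.testBit_and, Nat.testBit_shiftRight, show (4294967295 : ℕ) = 2 ^ 32 - 1 by norm_num,
    Nat.testBit_two_pow_sub_one, Bool.and_comm]
theorem tb_bt (i j : ℕ) : (bt i).testBit j = decide (i = j) := by
  show (1 <<< i).testBit j = _
  rw [Nat.one_shiftLeft, Nat.testBit_two_pow]
theorem tb_sub (A X j : ℕ) : (sub A X).testBit j = (A.testBit j && !X.testBit j) := by
  show (A ^^^ (A &&& X)).testBit j = _
  rw [Nat.testBit_xor, Nat.testBit_and]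
  cases A.testBit j <;> simp
theorem tb_lor (A X j : ℕ) : (Nat.lor A X).testBit j = (A.testBit j || X.testBit j) := Nat.testBit_or ..
theorem tb_land (A X j : ℕ) : (Nat.land A X).testBit j = (A.testBit j && X.testBit j) := Nat.testBit_and ..
theorem tb_shl (A i j : ℕ) : (Nat.shiftLeft A i).testBit j = (decide (j ≥ i) && A.testBit (j - i)) := Nat.testBit_shiftLeft ..
theorem tb_shr (A i j : ℕ) : (Nat.shiftRight A i).testBit j = A.testBit (i + j) := Nat.testBit_shiftRight ..

theorem tb_one (j : ℕ) : (1 : ℕ).testBit j = decide (0 = j) := by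
  have := @Nat.testBit_two_pow 0 j
  simpa using this
/-- only bits at multiples of 32 -/
def IsCol (t : ℕ) : Prop := ∀ k, t.testBit k = true → k % 32 = 0

theorem split32 (x : ℕ) : x = 2 ^ 32 * (x / 2 ^ 32) + x % 2 ^ 32 := by omega
theorem isCol_div {t : ℕ} (h : IsCol t) : IsCol (t / 2 ^ 32) := by
  intro k hk
  have := h (k + 32) (by rw [← Nat.testBit_div_two_pow]; exact hk)
  omega
theorem isCol_mod {t : ℕ} (h : IsCol t) : t % 2 ^ 32 = (t.testBit 0).toNat := by
  apply Nat.eq_of_testBit_eq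
  intro j
  rw [Nat.testBit_mod_two_pow]
  by_cases hj : j = 0
  · subst hj; cases t.testBit 0 <;> simp
  · have : (t.testBit 0).toNat.testBit j = false := by
      cases t.testBit 0
      · simp
      · simp only [Bool.toNat_true, tb_one]
        simp; omega
    rw [this]
    by_contra hc
    have hc' : (decide (j < 32) = true) ∧ t.testBit j = true := by simpa using hc
    have := h j hc'.2
    simp at hc'
    omega
theorem tb_split (a b k : ℕ) (hb : b < 2 ^ 32) :
    (2 ^ 32 * a + b).testBit k = if k < 32 then b.testBit k else a.testBit (k - 32) := Nat.testBit_two_pow_mul_add a hb k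
theorem tb_colmul (i j : ℕ) (hj : j < 32) (Y : ℕ) (hY : Y < 2 ^ 32) : ∀ t : ℕ, IsCol t →
    (Nat.mul t Y).testBit (32 * i + j) = (t.testBit (32 * i) && Y.testBit j) := by
  induction i with
  | zero =>
    intro t ht
    have h1 : Nat.mul t Y = 2 ^ 32 * (t / 2 ^ 32 * Y) + (t.testBit 0).toNat * Y := by
      show t * Y = _
      conv_lhs => rw [split32 t, isCol_mod ht]
      ring
    rw [h1, tb_split]
    · have : 32 * 0 + j < 32 := by omega
      rw [if_pos this]
      cases t.testBit 0 <;> simp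
    · cases t.testBit 0 <;> simp <;> omega
  | succ i ih =>
    intro t ht
    have h1 : Nat.mul t Y = 2 ^ 32 * (t / 2 ^ 32 * Y) + (t.testBit 0).toNat * Y := by
      show t * Y = _
      conv_lhs => rw [split32 t, isCol_mod ht]
      ring
    rw [h1, tb_split]
    · have : ¬ 32 * (i + 1) + j < 32 := by omega
      rw [if_neg this, show 32 * (i + 1) + j - 32 = 32 * i + j by omega]
      refine (ih _ (isCol_div ht)).trans ?_
      rw [Nat.testBit_div_two_pow, show 32 * i + 32 = 32 * (i + 1) by ring]
    · cases t.testBit 0 <;> simp <;> omega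

theorem rep_succ (n a : ℕ) : rep (n + 1) a = 2 ^ 32 * rep n a + a := by
  show a + 4294967296 * rep n a = _
  norm_num; ring
theorem rep_mul (n a : ℕ) : Nat.mul (rep n 1) a = rep n a := by
  show rep n 1 * a = _
  induction n with
  | zero => show 0 * a = 0; simp
  | succ n ih => rw [rep_succ, rep_succ, ← ih]; ring
theorem tb_rep (a : ℕ) (ha : a < 2 ^ 32) (j : ℕ) (hj : j < 32) (n : ℕ) : ∀ i,
    (rep n a).testBit (32 * i + j) = (decide (i < n) && a.testBit j) := by
  induction n with
  | zero => intro i; show (0 : ℕ).testBit _ = _; simp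
  | succ n ih =>
    intro i
    rw [rep_succ, tb_split _ _ _ ha]
    cases i with
    | zero => rw [if_pos (by omega)]; simp
    | succ i =>
      rw [if_neg (by omega), show 32 * (i + 1) + j - 32 = 32 * i + j by omega, ih]
      simp
theorem isCol_rep (n : ℕ) : IsCol (rep n 1) := by
  intro k hk
  rw [show k = 32 * (k / 32) + k % 32 by omega, tb_rep 1 (by norm_num) _ (by omega)] at hk
  simp [tb_one] at hk
  omega

theorem tb_nz_aux (n : ℕ) : ∀ i x, i < n → (∀ k, x.testBit k = true → k % 32 ≠ 31) →
    (x + rep n 2147483647).testBit (32 * i + 31) = decide (row x i ≠ 0) := by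
  induction n with
  | zero => intro i x hi; omega
  | succ n ih =>
    intro i x hi hx
    have hlt : x % 2 ^ 32 < 2 ^ 31 := by
      apply Nat.lt_pow_two_of_testBit
      intro k hk
      rw [Nat.testBit_mod_two_pow]
      by_contra hc
      simp at hc
      have := hx k hc.2
      omega
    have h1 : x + rep (n + 1) 2147483647 = 2 ^ 32 * (x / 2 ^ 32 + rep n 2147483647) + (x % 2 ^ 32 + 2147483647) := by
      rw [rep_succ]; omega
    rw [h1, tb_split _ _ _ (by omega)]
    cases i with
    | zero =>
      rw [if_pos (by omega)]
      have : row x 0 = x % 2 ^ 32 := by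
        apply Nat.eq_of_testBit_eq; intro j; rw [tb_row, Nat.testBit_mod_two_pow]; simp
      rw [this]
      generalize x % 2 ^ 32 = y at *
      rw [Nat.testBit_eq_decide_div_mod_eq]
      congr 1
      simp
      omega
    | succ i =>
      rw [if_neg (by omega), show 32 * (i + 1) + 31 - 32 = 32 * i + 31 by omega, ih _ _ (by omega)]
      · have : row (x / 2 ^ 32) i = row x (i + 1) := by
          apply Nat.eq_of_testBit_eq; intro j; rw [tb_row, tb_row, Nat.testBit_div_two_pow]
          rw [show 32 * i + j + 32 = 32 * (i + 1) + j by ring]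
        rw [this]
      · intro k hk
        rw [Nat.testBit_div_two_pow] at hk
        have := hx _ hk
        omega

theorem row_ne_zero (x i : ℕ) : row x i ≠ 0 ↔ ∃ j, j < 32 ∧ x.testBit (32 * i + j) = true := by
  constructor
  · intro h
    obtain ⟨j, hj⟩ := Nat.exists_testBit_of_ne_zero h
    rw [tb_row] at hj
    simp at hj
    exact ⟨j, hj⟩
  · rintro ⟨j, hj, h⟩ h0
    have := tb_row x i j
    rw [h0] at this
    simp [hj, h] at this

theorem tb_c2r_aux (m : ℕ) : ∀ t, IsCol t → t < 2 ^ (32 * m) → m ≤ 30 →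
    ∃ r, r < 2 ^ m ∧ t % 2147483647 = r % 2147483647 ∧ ∀ w, r.testBit w = (decide (w < m) && t.testBit (32 * w)) := by
  induction m with
  | zero => intro t _ h _; refine ⟨0, by simp, ?_, by simp⟩; have : t = 0 := by simpa using h
            rw [this]
  | succ m ih =>
    intro t ht hlt hm
    obtain ⟨r, hr, hmod, hb⟩ := ih (t / 2 ^ 32) (isCol_div ht) (by
      rw [Nat.div_lt_iff_lt_mul (by norm_num), ← pow_add]
      rwa [show 32 * m + 32 = 32 * (m + 1) by ring]) (by omega)
    refine ⟨2 * r + (t.testBit 0).toNat, ?_, ?_, ?_⟩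
    · rw [pow_succ]; have := Bool.toNat_lt (t.testBit 0); omega
    · have := split32 t
      rw [isCol_mod ht] at this
      norm_num at *
      omega
    · intro w
      cases w with
      | zero =>
        rw [Nat.testBit_zero]
        have := Bool.toNat_lt (t.testBit 0)
        cases t.testBit 0 <;> simp <;> omega
      | succ w =>
        rw [Nat.testBit_succ]
        have := Bool.toNat_lt (t.testBit 0)
        rw [show (2 * r + (t.testBit 0).toNat) / 2 = r by omega, hb w, Nat.testBit_div_two_pow]
        rw [show 32 * w + 32 = 32 * (w + 1) by ring]
        simp
theorem tb_c2r (m t : ℕ) (ht : IsCol t) (hlt : t < 2 ^ (32 * m)) (hm : m ≤ 30) (w : ℕ) :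
    (c2r t).testBit w = t.testBit (32 * w) := by
  obtain ⟨r, hr, hmod, hb⟩ := tb_c2r_aux m t ht hlt hm
  have h1 : c2r t = r := by
    show t % 2147483647 = r
    rw [hmod]
    apply Nat.mod_eq_of_lt
    have : 2 ^ m ≤ 2 ^ 30 := Nat.pow_le_pow_right (by norm_num) hm
    norm_num at this
    omega
  rw [h1, hb]
  by_cases h : w < m
  · simp [h]
  · simp [h]
    apply Nat.testBit_lt_two_pow
    exact lt_of_lt_of_le hlt (Nat.pow_le_pow_right (by norm_num) (by omega))
end TS

namespace TS
structure OK (c : Cfg) (n : ℕ) : Prop where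
  hn : n ≤ 26
  col : c.col = rep n 1
  m31 : c.m31 = rep n 2147483647
  allr : ∀ j, c.allr.testBit j = decide (j < n)
  all : ∀ i j, j < 32 → c.all.testBit (32 * i + j) = (decide (i < n) && decide (j < n))
  offd : ∀ i j, j < 31 → i < n → i ≠ j → c.offd.testBit (32 * i + j) = true
  offd' : ∀ k, c.offd.testBit k = true → k % 32 ≠ 31
  M : ∀ j, c.M.testBit j = true → j < n
  Mc : ∀ i j, j < 32 → c.Mc.testBit (32 * i + j) = (decide (j = 0) && c.M.testBit i)

structure Valid (c : Cfg) (n : ℕ) (P : ℕ → ℕ → Bool) : Prop where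
  lt : ∀ x y, P x y = true → x < n ∧ y < n
  irr : ∀ x, ¬ P x x = true
  sym : ∀ x y, P x y = true → P y x = true
  tri : ∀ a b d, P a b = true → P b d = true → P a d = true → False
  quad : ∀ a b d e, P a b = true → P b d = true → P d e = true → P e a = true → a = d ∨ b = e
  deg : ∀ x, ((Finset.range n).filter (fun y => P x y = true)).card = row c.D x
  cap : ∀ x, ((Finset.range n).filter (fun y => P x y = true ∧ c.M.testBit y = true)).card ≤ row c.K x

structure Inv (n C : ℕ) (P : ℕ → ℕ → Bool) (E A : ℕ) : Prop where
  e1 : ∀ k, E.testBit k = true → P (k / 32) (k % 32) = true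
  es : ∀ x y, x < 32 → y < 32 → E.testBit (32 * x + y) = true → E.testBit (32 * y + x) = true
  as : ∀ x y, x < n → y < n → A.testBit (32 * x + y) = true → A.testBit (32 * y + x) = true
  cov : ∀ x y, P x y = true → E.testBit (32 * x + y) = true ∨ A.testBit (32 * x + y) = true
  cl : ∀ x j, x < n → 26 ≤ j → j < 31 → A.testBit (32 * x + j) = C.testBit (32 * x + j)

theorem lt32_of_tb {X : ℕ} (h : ∀ j, X.testBit j = true → j < 32) : X < 2 ^ 32 := by
  apply Nat.lt_pow_two_of_testBit
  intro i hi
  by_contra hc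
  have := h i (by simpa using hc)
  omega

theorem tb_rowshl (X z x y : ℕ) (hy : y < 32) (hX : ∀ j, X.testBit j = true → j < 32) :
    (Nat.shiftLeft X (Nat.mul 32 z)).testBit (32 * x + y) = true ↔ x = z ∧ X.testBit y = true := by
  rw [tb_shl]
  show (decide (32 * x + y ≥ 32 * z) && X.testBit (32 * x + y - 32 * z)) = true ↔ _
  simp only [Bool.and_eq_true, decide_eq_true_eq]
  constructor
  · rintro ⟨h1, h2⟩
    have := hX _ h2
    have hx : x = z := by omega
    subst hx
    refine ⟨rfl, ?_⟩
    rwa [show 32 * x + y - 32 * x = y by omega] at h2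
  · rintro ⟨rfl, h⟩
    refine ⟨by omega, ?_⟩
    rwa [show 32 * x + y - 32 * x = y by omega]

theorem tb_colshl (t z x y : ℕ) (hy : y < 32) (hz : z < 32) (ht : IsCol t) :
    (Nat.shiftLeft t z).testBit (32 * x + y) = true ↔ y = z ∧ t.testBit (32 * x) = true := by
  rw [tb_shl]
  simp only [Bool.and_eq_true, decide_eq_true_eq]
  constructor
  · rintro ⟨h1, h2⟩
    have := ht _ h2
    have hx : y = z := by omega
    subst hx
    refine ⟨rfl, ?_⟩
    rwa [show 32 * x + y - y = 32 * x by omega] at h2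
  · rintro ⟨rfl, h⟩
    refine ⟨by omega, ?_⟩
    rwa [show 32 * x + y - y = 32 * x by omega]

section
variable {c : Cfg} {n C : ℕ} {P : ℕ → ℕ → Bool} {E A : ℕ}

theorem tb_col (h : OK c n) (i : ℕ) : c.col.testBit (32 * i) = decide (i < n) := by
  rw [h.col]
  have := tb_rep 1 (by norm_num) 0 (by norm_num) n i
  simpa using this
theorem isCol_col (h : OK c n) : IsCol c.col := by rw [h.col]; exact isCol_rep n
theorem isCol_and {a b : ℕ} (h : IsCol b) : IsCol (Nat.land a b) := by
  intro k hk; rw [tb_land] at hk; simp at hk; exact h k hk.2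
theorem lt_of_sub_col (h : OK c n) {t : ℕ} (ht : ∀ k, t.testBit k = true → c.col.testBit k = true) : t < 2 ^ (32 * n) := by
  apply Nat.lt_pow_two_of_testBit
  intro i hi
  by_contra hc
  have h1 := ht i (by simpa using hc)
  have h2 := isCol_col h i h1
  rw [show i = 32 * (i / 32) by omega, tb_col h] at h1
  simp at h1
  omega
theorem tb_nz (h : OK c n) (x i : ℕ) (hx : ∀ k, x.testBit k = true → k % 32 ≠ 31) :
    (nz c x).testBit (32 * i) = true ↔ i < n ∧ ∃ j, j < 32 ∧ x.testBit (32 * i + j) = true := by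
  unfold nz
  rw [tb_land, tb_shr, tb_col h, h.m31]
  by_cases hi : i < n
  · have := tb_nz_aux n i x hi hx
    rw [show 31 + 32 * i = 32 * i + 31 by ring]
    rw [show Nat.add x (rep n 2147483647) = x + rep n 2147483647 from rfl, this]
    simp only [hi, decide_true, Bool.and_true, true_and, decide_eq_true_eq]
    exact row_ne_zero x i
  · simp [hi]
theorem nz_col (h : OK c n) (x : ℕ) : ∀ k, (nz c x).testBit k = true → c.col.testBit k = true := by
  intro k hk; unfold nz at hk; rw [tb_land] at hk; simp at hk; exact hk.2
theorem isCol_of (h : OK c n) {t : ℕ} (ht : ∀ k, t.testBit k = true → c.col.testBit k = true) : IsCol t :=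
  fun k hk => isCol_col h k (ht k hk)
theorem tb_c2r' (h : OK c n) {t : ℕ} (ht : ∀ k, t.testBit k = true → c.col.testBit k = true) (w : ℕ) :
    (c2r t).testBit w = t.testBit (32 * w) :=
  tb_c2r n t (isCol_of h ht) (lt_of_sub_col h ht) (by have := h.hn; omega) w

theorem e_P (I : Inv n C P E A) {x y : ℕ} (hy : y < 32) (h : E.testBit (32 * x + y) = true) : P x y = true := by
  have := I.e1 _ h
  rwa [show (32 * x + y) / 32 = x by omega, show (32 * x + y) % 32 = y by omega] at this

/-- second neighbours -/
theorem tb_a2 (h : OK c n) (V : Valid c n P) (I : Inv n C P E A) (u x : ℕ) :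
    (nz c (Nat.land E (Nat.mul c.col (row E u)))).testBit (32 * x) = true ↔
      ∃ j, j < 32 ∧ E.testBit (32 * x + j) = true ∧ E.testBit (32 * u + j) = true := by
  have hlt : row E u < 2 ^ 32 := lt32_of_tb (by intro j hj; rw [tb_row] at hj; simp at hj; exact hj.1)
  rw [tb_nz h]
  · constructor
    · rintro ⟨hx, j, hj, hb⟩
      rw [tb_land, tb_colmul x j hj _ hlt _ (isCol_col h), tb_row] at hb
      simp at hb
      exact ⟨j, hj, hb.1, hb.2.2.2⟩
    · rintro ⟨j, hj, h1, h2⟩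
      have hx := (V.lt _ _ (e_P I hj h1)).1
      refine ⟨hx, j, hj, ?_⟩
      rw [tb_land, tb_colmul x j hj _ hlt _ (isCol_col h), tb_row, tb_col h]
      simp [h1, h2, hj, hx]
  · intro k hk
    rw [tb_land] at hk
    simp at hk
    have := (V.lt _ _ (I.e1 _ hk.1)).2
    have := h.hn
    omega

theorem tb_getc (h : OK c n) (V : Valid c n P) (I : Inv n C P E A) (v x : ℕ) (hv : v < 32) :
    (getc c E v).testBit (32 * x) = true ↔ E.testBit (32 * x + v) = true := by
  unfold getc
  rw [tb_land, tb_shr, tb_col h, show v + 32 * x = 32 * x + v by ring]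
  simp only [Bool.and_eq_true, decide_eq_true_eq, and_iff_left_iff_imp]
  intro hh
  exact (V.lt _ _ (e_P I hv hh)).1

theorem tb_kill (h : OK c n) (V : Valid c n P) (I : Inv n C P E A) {u v : ℕ} (hu : u < n) (hv : v < n)
    (x y : ℕ) (hy : y < 32) :
    (kill c E u v (row E u) (getc c E v)).testBit (32 * x + y) = true ↔
      (x = v ∧ (E.testBit (32 * u + y) = true ∨ (∃ j, j < 32 ∧ E.testBit (32 * y + j) = true ∧ E.testBit (32 * u + j) = true) ∨ y = u))
      ∨ (E.testBit (32 * x + v) = true ∧ (E.testBit (32 * u + y) = true ∨ y = u))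
      ∨ (y = v ∧ ∃ j, j < 32 ∧ E.testBit (32 * x + j) = true ∧ E.testBit (32 * u + j) = true) := by
  have hn := h.hn
  unfold kill
  simp only []
  have hcr : ∀ j, (c2r (nz c (Nat.land E (Nat.mul c.col (row E u))))).testBit j = true ↔ 
     ∃ i, i < 32 ∧ E.testBit (32 * j + i) = true ∧ E.testBit (32 * u + i) = true := by
    intro j; rw [tb_c2r' h (nz_col h _), tb_a2 h V I]
  have hrow : ∀ j, (row E u).testBit j = true ↔ j < 32 ∧ E.testBit (32 * u + j) = true := by
    intro j; rw [tb_row]; simp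
  rw [tb_lor, tb_lor, Bool.or_eq_true, Bool.or_eq_true, tb_rowshl _ _ _ _ hy, tb_colshl _ _ _ _ hy (by omega) (isCol_of h (nz_col h _)),
    tb_a2 h V I, tb_colmul _ _ hy, Bool.and_eq_true, tb_getc h V I _ _ (by omega), tb_lor, tb_lor, tb_lor, tb_bt]
  · simp only [Bool.or_eq_true, hcr, hrow, decide_eq_true_eq, hy, true_and]
    have : u = y ↔ y = u := eq_comm
    rw [this]
    simp only [or_assoc]
  · apply lt32_of_tb
    intro j hj
    rw [tb_lor, tb_bt, Bool.or_eq_true, hrow] at hj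
    simp at hj
    omega
  · exact isCol_and (isCol_col h)
  · intro j hj
    rw [tb_lor, tb_lor, tb_bt, Bool.or_eq_true, Bool.or_eq_true, hrow, hcr] at hj
    simp at hj
    rcases hj with (hj | ⟨i, hi, h1, h2⟩) | hj
    · exact hj.1
    · have := (V.lt _ _ (e_P I hi h1)).1
      omega
    · omega
end
end TS

namespace TS
section
variable {c : Cfg} {n C : ℕ} {P : ℕ → ℕ → Bool} {E A : ℕ}

theorem Inv_sub (h : OK c n) (V : Valid c n P) (I : Inv n C P E A) {X : ℕ}
    (hs : ∀ x y, x < n → y < n → X.testBit (32 * x + y) = true → X.testBit (32 * y + x) = true)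
    (hc : ∀ x j, j < 32 → X.testBit (32 * x + j) = true → j < n)
    (hp : ∀ x y, P x y = true → X.testBit (32 * x + y) = true → E.testBit (32 * x + y) = true) :
    Inv n C P E (sub A X) where
  e1 := I.e1
  es := I.es
  as := by
    intro x y hx hy hb
    rw [tb_sub] at hb ⊢
    simp only [Bool.and_eq_true, Bool.not_eq_true'] at hb ⊢
    refine ⟨I.as x y hx hy hb.1, ?_⟩
    by_contra hk
    have := hs y x hy hx (by simpa using hk)
    simp [this] at hb
  cov := by
    intro x y hxy
    rw [tb_sub]
    rcases I.cov x y hxy with h1 | h1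
    · exact Or.inl h1
    · by_cases hX : X.testBit (32 * x + y) = true
      · exact Or.inl (hp x y hxy hX)
      · right; simp [h1, hX]
  cl := by
    intro x j hx hj hj'
    rw [tb_sub, I.cl x j hx hj hj']
    have : X.testBit (32 * x + j) = false := by
      by_contra hk
      have := hc x j (by omega) (by simpa using hk)
      have := h.hn
      omega
    simp [this]

theorem tb_addE (u v x y : ℕ) (hy : y < 32) (hu : u < 32) (hv : v < 32) : (addE E u v).testBit (32 * x + y) = true ↔
    E.testBit (32 * x + y) = true ∨ (x = u ∧ y = v) ∨ (x = v ∧ y = u) := by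
  unfold addE
  rw [tb_lor, tb_lor, tb_bt, tb_bt]
  simp only [Bool.or_eq_true, decide_eq_true_eq]
  show _ ∨ (32 * u + v = _ ∨ 32 * v + u = _) ↔ _
  constructor
  · rintro (h | h | h)
    · exact Or.inl h
    · right; left; omega
    · right; right; omega
  · rintro (h | h | h)
    · exact Or.inl h
    · right; left; omega
    · right; right; omega

theorem Inv_addE (h : OK c n) (V : Valid c n P) (I : Inv n C P E A) {u v : ℕ} (huv : P u v = true) :
    Inv n C P (addE E u v) A := by
  have hu := (V.lt _ _ huv).1
  have hv := (V.lt _ _ huv).2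
  have hn := h.hn
  refine ⟨?_, ?_, I.as, ?_, I.cl⟩
  · intro k hk
    rw [show k = 32 * (k / 32) + k % 32 by omega, tb_addE _ _ _ _ (by omega) (by omega) (by omega)] at hk
    rcases hk with hk | hk | hk
    · rw [show 32 * (k / 32) + k % 32 = k by omega] at hk; exact I.e1 k hk
    · rw [hk.1, hk.2]; exact huv
    · rw [hk.1, hk.2]; exact V.sym _ _ huv
  · intro x y hx hy hh
    rw [tb_addE _ _ _ _ (by omega) (by omega) (by omega)] at hh ⊢
    rcases hh with hk | hk | hk
    · exact Or.inl (I.es _ _ hx hy hk)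
    · exact Or.inr (Or.inr ⟨hk.2, hk.1⟩)
    · exact Or.inr (Or.inl ⟨hk.2, hk.1⟩)
  · intro x y hxy
    have := (V.lt _ _ hxy)
    rw [tb_addE _ _ _ _ (by omega) (by omega) (by omega)]
    rcases I.cov x y hxy with h1 | h1
    · exact Or.inl (Or.inl h1)
    · exact Or.inr h1

theorem kill_lt (h : OK c n) (V : Valid c n P) (I : Inv n C P E A) {u v : ℕ} (hu : u < n) (hv : v < n)
    (x y : ℕ) (hy : y < 32) (hb : (kill c E u v (row E u) (getc c E v)).testBit (32 * x + y) = true) : y < n := by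
  rw [tb_kill h V I hu hv x y hy] at hb
  rcases hb with ⟨_, h1 | ⟨j, hj, h1, h2⟩ | h1⟩ | ⟨_, h1 | h1⟩ | ⟨h1, _⟩
  · exact (V.lt _ _ (e_P I hy h1)).2
  · exact (V.lt _ _ (e_P I hj h1)).1
  · omega
  · exact (V.lt _ _ (e_P I hy h1)).2
  · omega
  · omega

theorem kill_ok (h : OK c n) (V : Valid c n P) (I : Inv n C P E A) {u v : ℕ} (huv : P u v = true)
    (x y : ℕ) (hxy : P x y = true) (hb : (kill c E u v (row E u) (getc c E v)).testBit (32 * x + y) = true) :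
    E.testBit (32 * x + y) = true ∨ (x = u ∧ y = v) ∨ (x = v ∧ y = u) := by
  obtain ⟨hu, hv⟩ := V.lt _ _ huv
  obtain ⟨hx, hy⟩ := V.lt _ _ hxy
  have hn := h.hn
  have hvu := V.sym _ _ huv
  have hyx := V.sym _ _ hxy
  rw [tb_kill h V I hu hv x y (by omega)] at hb
  rcases hb with ⟨e, h1 | ⟨j, hj, h1, h2⟩ | h1⟩ | ⟨e, h1 | h1⟩ | ⟨e, j, hj, h1, h2⟩
  · subst e
    exact (V.tri _ _ _ hvu (e_P I (by omega) h1) hxy).elim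
  · subst e
    rcases V.quad x y j u hxy (e_P I hj h1) (V.sym _ _ (e_P I hj h2)) huv with e | e
    · subst e
      left; exact I.es _ _ (by omega) (by omega) h1
    · right; right; exact ⟨rfl, e⟩
  · right; right; exact ⟨e, h1⟩
  · rcases V.quad x v u y (e_P I (by omega) e) hvu (e_P I (by omega) h1) hyx with e' | e'
    · subst e'; left; exact h1
    · subst e'; left; exact e
  · subst h1
    exact (V.tri _ _ _ hxy huv (e_P I (by omega) e)).elim
  · subst e
    rcases V.quad x j u y (e_P I hj h1) (V.sym _ _ (e_P I hj h2)) huv hyx with e | e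
    · right; left; exact ⟨e, rfl⟩
    · subst e; left; exact h1

theorem Inv_kill (h : OK c n) (V : Valid c n P) (I : Inv n C P E A) {u v : ℕ} (huv : P u v = true) :
    Inv n C P (addE E u v) (sub A (Nat.lor (kill c E u v (row E u) (getc c E v)) (kill c E v u (row E v) (getc c E u)))) := by
  obtain ⟨hu, hv⟩ := V.lt _ _ huv
  have hn := h.hn
  have hvu := V.sym _ _ huv
  have es : ∀ x y, x < n → y < n → E.testBit (32 * x + y) = true → E.testBit (32 * y + x) = true :=
    fun x y hx hy => I.es x y (by omega) (by omega)
  have key : ∀ u v, u < n → v < n → ∀ x y, x < n → y < n → (kill c E u v (row E u) (getc c E v)).testBit (32 * x + y) = true →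
    (kill c E u v (row E u) (getc c E v)).testBit (32 * y + x) = true ∨ (kill c E v u (row E v) (getc c E u)).testBit (32 * y + x) = true := by
    intro u v hu hv x y hx hy hb
    rw [tb_kill h V I hu hv x y (by omega)] at hb
    rw [tb_kill h V I hu hv y x (by omega), tb_kill h V I hv hu y x (by omega)]
    rcases hb with ⟨e, h1 | h1 | h1⟩ | ⟨e, h1 | h1⟩ | ⟨e, h1⟩
    · right; right; left; exact ⟨es _ _ hu hy h1, Or.inr e⟩
    · left; right; right; exact ⟨e, h1⟩
    · right; left; exact ⟨h1, Or.inr (Or.inr e)⟩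
    · right; right; left; exact ⟨es _ _ hu hy h1, Or.inl (es _ _ hx hv e)⟩
    · right; left; exact ⟨h1, Or.inl (es _ _ hx hv e)⟩
    · left; left; exact ⟨e, Or.inr (Or.inl h1)⟩
  apply Inv_sub h V (Inv_addE h V I huv)
  · intro x y hx hy hb
    rw [tb_lor, Bool.or_eq_true] at hb ⊢
    rcases hb with hb | hb
    · exact key u v hu hv x y hx hy hb
    · exact (key v u hv hu x y hx hy hb).symm
  · intro x j hj hb
    rw [tb_lor, Bool.or_eq_true] at hb
    rcases hb with hb | hb
    · exact kill_lt h V I hu hv x j hj hb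
    · exact kill_lt h V I hv hu x j hj hb
  · intro x y hxy hb
    have := V.lt _ _ hxy
    rw [tb_lor, Bool.or_eq_true] at hb
    rw [tb_addE _ _ _ _ (by omega) (by omega) (by omega)]
    rcases hb with hb | hb
    · exact kill_ok h V I huv x y hxy hb
    · have := kill_ok h V I hvu x y hxy hb
      tauto

theorem tl_le (x : ℕ) (hx : x ≠ 0) : tl x < x := by
  have : tl x ≤ x - 1 := Nat.and_le_right
  omega
theorem tb_tl (x j : ℕ) (h : (tl x).testBit j = true) : x.testBit j = true := by
  unfold tl at h; rw [tb_land] at h; simp at h; exact h.1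
theorem pcl_le (f : ℕ) : ∀ x, x < 2 ^ 32 → pcl f x ≤ ((Finset.range 32).filter (fun j => x.testBit j = true)).card := by
  induction f with
  | zero => intro x _; exact Nat.zero_le _
  | succ f ih =>
    intro x hx
    show ifn (Nat.beq x 0) 0 (Nat.succ (pcl f (tl x))) ≤ _
    rw [ifn_eq]
    by_cases h0 : x = 0
    · subst h0; simp
    · rw [if_neg (by simpa using h0)]
      have h1 := ih (tl x) (lt_trans (tl_le x h0) hx)
      refine Nat.succ_le_of_lt (lt_of_le_of_lt h1 (Finset.card_lt_card ?_))
      refine Finset.ssubset_iff_subset_ne.2 ⟨?_, ?_⟩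
      · intro j; simp only [Finset.mem_filter]; rintro ⟨a, b⟩; exact ⟨a, tb_tl x j b⟩
      · intro heq
        have : tl x = x := by
          apply Nat.eq_of_testBit_eq
          intro j
          by_cases hj : j < 32
          · have := congrArg (fun s => j ∈ s) heq
            simp only [Finset.mem_filter, Finset.mem_range, hj, true_and] at this
            rw [Bool.eq_iff_iff]; exact iff_of_eq this
          · rw [Nat.testBit_eq_false_of_lt (lt_of_lt_of_le (lt_trans (tl_le x h0) hx) (Nat.pow_le_pow_right (by norm_num) (by omega))),
              Nat.testBit_eq_false_of_lt (lt_of_lt_of_le hx (Nat.pow_le_pow_right (by norm_num) (by omega)))]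
        have := tl_le x h0
        omega

theorem Inv_capD (h : OK c n) (V : Valid c n P) (I : Inv n C P E A) {z : ℕ} (hz : z < n) :
    Inv n C P E (capD c E z A) := by
  have hn := h.hn
  unfold capD
  rw [ifn_eq]
  split_ifs with hb
  swap; exact I
  have hb := Nat.le_of_ble_eq_true hb
  have hpc := pcl_le 12 (row E z) (lt32_of_tb (by intro j hj; rw [tb_row] at hj; simp at hj; exact hj.1))
  have hd := V.deg z
  have hsub : ((Finset.range 32).filter (fun j => (row E z).testBit j = true)) ⊆ ((Finset.range n).filter (fun y => P z y = true)) := by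
    intro j
    simp only [Finset.mem_filter, Finset.mem_range]
    rintro ⟨hj, hh⟩
    rw [tb_row] at hh; simp at hh
    have := e_P I hj hh.2
    exact ⟨(V.lt _ _ this).2, this⟩
  have heq := Finset.eq_of_subset_of_card_le hsub (by omega)
  have hE : ∀ y, P z y = true → E.testBit (32 * z + y) = true := by
    intro y hy
    have : y ∈ ((Finset.range 32).filter (fun j => (row E z).testBit j = true)) := by
      rw [heq]; simp [hy, (V.lt _ _ hy).2]
    simp only [Finset.mem_filter, tb_row] at this
    simp at this
    exact this.2
  have htb : ∀ x y, y < 32 → ((Nat.lor (Nat.shiftLeft c.allr (Nat.mul 32 z)) (Nat.shiftLeft c.col z)).testBit (32 * x + y) = true ↔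
    (x = z ∧ y < n) ∨ (y = z ∧ x < n)) := by
    intro x y hy
    rw [tb_lor, Bool.or_eq_true, tb_rowshl _ _ _ _ hy, tb_colshl _ _ _ _ hy (by omega) (isCol_col h), tb_col h, h.allr]
    · simp
    · intro j hj; rw [h.allr] at hj; simp at hj; omega
  apply Inv_sub h V I
  · intro x y hx hy
    rw [htb x y (by omega), htb y x (by omega)]
    omega
  · intro x j hj; rw [htb x j hj]; omega
  · intro x y hxy
    have := V.lt _ _ hxy
    rw [htb x y (by omega)]
    rintro (⟨rfl, _⟩ | ⟨rfl, _⟩)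
    · exact hE y hxy
    · exact I.es _ _ (by omega) (by omega) (hE x (V.sym _ _ hxy))

theorem Inv_capK (h : OK c n) (V : Valid c n P) (I : Inv n C P E A) {z : ℕ} (hz : z < n) :
    Inv n C P E (capK c E z A) := by
  have hn := h.hn
  unfold capK
  rw [ifn_eq]
  split_ifs with hb
  swap; exact I
  have hb := Nat.le_of_ble_eq_true hb
  have hpc := pcl_le 12 (Nat.land (row E z) c.M) (lt32_of_tb (by intro j hj; rw [tb_land, tb_row] at hj; simp at hj; exact hj.1.1))
  have hd := V.cap z
  have hsub : ((Finset.range 32).filter (fun j => (Nat.land (row E z) c.M).testBit j = true)) ⊆ ((Finset.range n).filter (fun y => P z y = true ∧ c.M.testBit y = true)) := by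
    intro j
    simp only [Finset.mem_filter, Finset.mem_range]
    rintro ⟨hj, hh⟩
    rw [tb_land, tb_row] at hh; simp at hh
    have := e_P I hj hh.1.2
    exact ⟨(V.lt _ _ this).2, this, hh.2⟩
  have heq := Finset.eq_of_subset_of_card_le hsub (by omega)
  have hE : ∀ y, P z y = true → c.M.testBit y = true → E.testBit (32 * z + y) = true := by
    intro y hy hm
    have : y ∈ ((Finset.range 32).filter (fun j => (Nat.land (row E z) c.M).testBit j = true)) := by
      rw [heq]; simp [hy, (V.lt _ _ hy).2, hm]
    simp only [Finset.mem_filter, tb_land, tb_row] at this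
    simp at this
    exact this.2.1.2
  have htb : ∀ x y, y < 32 → ((Nat.lor (Nat.shiftLeft c.M (Nat.mul 32 z)) (Nat.shiftLeft c.Mc z)).testBit (32 * x + y) = true ↔
    (x = z ∧ c.M.testBit y = true) ∨ (y = z ∧ c.M.testBit x = true)) := by
    intro x y hy
    have hMc : IsCol c.Mc := by
      intro k hk
      rw [show k = 32 * (k / 32) + k % 32 by omega, h.Mc _ _ (by omega)] at hk
      simp at hk; omega
    rw [tb_lor, Bool.or_eq_true, tb_rowshl _ _ _ _ hy, tb_colshl _ _ _ _ hy (by omega) hMc]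
    · have := h.Mc x 0 (by omega)
      simp only [Nat.add_zero] at this
      rw [this]; simp
    · intro j hj; have := h.M j hj; omega
  apply Inv_sub h V I
  · intro x y hx hy
    rw [htb x y (by omega), htb y x (by omega)]
    tauto
  · intro x j hj; rw [htb x j hj]
    rintro (⟨_, hm⟩ | ⟨rfl, _⟩)
    · exact h.M _ hm
    · exact hz
  · intro x y hxy
    have := V.lt _ _ hxy
    rw [htb x y (by omega)]
    rintro (⟨rfl, hm⟩ | ⟨rfl, hm⟩)
    · exact hE y hxy hm
    · exact I.es _ _ (by omega) (by omega) (hE x (V.sym _ _ hxy) hm)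

theorem Inv_capz (h : OK c n) (V : Valid c n P) (I : Inv n C P E A) {z : ℕ} (hz : z < n) :
    Inv n C P E (capz c E z A) := Inv_capK h V (Inv_capD h V I hz) hz

theorem Inv_addA (h : OK c n) (V : Valid c n P) (I : Inv n C P E A) {u v : ℕ} (huv : P u v = true) :
    Inv n C P (addE E u v) (addA c E (addE E u v) A u v) := by
  obtain ⟨hu, hv⟩ := V.lt _ _ huv
  exact Inv_capz h V (Inv_capz h V (Inv_kill h V I huv) hu) hv
end
end TS

namespace TS
section
variable {c : Cfg} {n C : ℕ} {P : ℕ → ℕ → Bool} {E A : ℕ}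

theorem cover_sound (h : OK c n) (V : Valid c n P) (I : Inv n C P E A) (r u fuel : ℕ) :
    ∀ X, cover E r u fuel X = true → ∀ S : Finset ℕ, (∀ y ∈ S, P u y = true ∧ X.testBit y = true) → S.card ≤ fuel := by
  induction fuel with
  | zero =>
    intro X hX S hS
    have h0 : X = 0 := by simpa [cover] using hX
    subst h0
    rcases S.eq_empty_or_nonempty with h | ⟨y, hy⟩
    · simp [h]
    · simpa using hS y hy
  | succ f ih =>
    intro X hX S hS
    have hX : ife (Nat.beq X 0) true (cover E r u f (Nat.xor X (Nat.land X (ifn (Nat.beq (Nat.land (row E (ix X)) r) 0) (bt (ix X)) (ifn (Nat.beq (ix (Nat.land (row E (ix X)) r)) u) (bt (ix X)) (row E (ix (Nat.land (row E (ix X)) r)))))))) = true := hX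
    rw [ife_eq] at hX
    by_cases h0 : X = 0
    · subst h0
      rcases S.eq_empty_or_nonempty with h | ⟨y, hy⟩
      · simp [h]
      · simpa using hS y hy
    rw [if_neg (by simpa using h0)] at hX
    have hZ : ∃ Z, cover E r u f (sub X Z) = true ∧ (∀ a b, P u a = true → P u b = true → Z.testBit a = true → Z.testBit b = true → a = b) := by
      refine ⟨_, hX, ?_⟩
      have hbt : ∀ i a b, P u a = true → P u b = true → (bt i).testBit a = true → (bt i).testBit b = true → a = b := by
        intro i a b _ _ h1 h2
        rw [tb_bt] at h1 h2
        simp at h1 h2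
        omega
      rw [ifn_eq, ifn_eq]
      split_ifs with h1 h2
      · exact hbt _
      · exact hbt _
      · intro a b ha hb h3 h4
        rw [tb_row] at h3 h4
        simp at h3 h4
        rcases V.quad u a _ b ha (V.sym _ _ (e_P I h3.1 h3.2)) (e_P I h4.1 h4.2) (V.sym _ _ hb) with e | e
        · exact (h2 (by simpa using e.symm)).elim
        · exact e
    obtain ⟨Z, hZ1, hZ2⟩ := hZ
    have h1 := ih _ hZ1 (S.filter (fun y => ¬ Z.testBit y = true)) (by
      intro y hy
      rw [Finset.mem_filter] at hy
      have := hS y hy.1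
      rw [tb_sub]
      simp [this.1, this.2, hy.2])
    have h2 : (S.filter (fun y => Z.testBit y = true)).card ≤ 1 := by
      rw [Finset.card_le_one]
      intro a ha b hb
      rw [Finset.mem_filter] at ha hb
      exact hZ2 a b (hS a ha.1).1 (hS b hb.1).1 ha.2 hb.2
    have h3 := Finset.card_filter_add_card_filter_not (s := S) (fun y => Z.testBit y = true)
    omega

theorem tb_twins (h : OK c n) (V : Valid c n P) (I : Inv n C P E A) {u v w : ℕ} (hv : v < n)
    (ht : (twins c E A u v).testBit (32 * w) = true) :
    w < n ∧ ∀ j, j < 31 → j ≠ v → j ≠ w → E.testBit (32 * w + j) = E.testBit (32 * v + j) ∧ A.testBit (32 * w + j) = A.testBit (32 * v + j) := by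
  have hn := h.hn
  have hlt : ∀ X i, row X i < 2 ^ 32 := fun X i => lt32_of_tb (by intro j hj; rw [tb_row] at hj; simp at hj; exact hj.1)
  unfold twins at ht
  rw [tb_land, tb_land, show ∀ a b, Nat.xor a b = a ^^^ b from fun _ _ => rfl, Nat.testBit_xor, tb_col h] at ht
  simp only [Bool.and_eq_true, decide_eq_true_eq] at ht
  obtain ⟨⟨_, hw⟩, hx⟩ := ht
  refine ⟨hw, ?_⟩
  simp only [hw, decide_true] at hx
  have hx : ¬ ((nz c (((E.xor (c.col.mul (row E v))).lor (A.xor (c.col.mul (row A v)))).land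
              (sub c.offd (c.col.shiftLeft v)))).testBit (32 * w) = true) := by simpa using hx
  rw [tb_nz h] at hx
  · intro j hj hjv hjw
    push Not at hx
    have := hx hw j (by omega)
    rw [tb_land, tb_sub, h.offd w j hj hw (Ne.symm hjw), tb_lor] at this
    have hcs : (c.col.shiftLeft v).testBit (32 * w + j) = false := by
      rw [← Bool.not_eq_true, tb_colshl _ _ _ _ (by omega) (by omega) (isCol_col h)]
      tauto
    rw [hcs, show ∀ a b, Nat.xor a b = a ^^^ b from fun _ _ => rfl, show ∀ a b, Nat.xor a b = a ^^^ b from fun _ _ => rfl,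
      Nat.testBit_xor, Nat.testBit_xor, tb_colmul _ _ (by omega) _ (hlt _ _) _ (isCol_col h), tb_colmul _ _ (by omega) _ (hlt _ _) _ (isCol_col h), tb_col h, tb_row, tb_row] at this
    have hj' : j < 32 := by omega
    simpa [hw, hj'] using this
  · intro k hk
    rw [tb_land, tb_sub] at hk
    simp only [Bool.and_eq_true] at hk
    exact h.offd' k hk.2.1

theorem twins_col (h : OK c n) (u v : ℕ) : ∀ k, (twins c E A u v).testBit k = true → c.col.testBit k = true := by
  intro k hk
  unfold twins at hk
  rw [tb_land, tb_land] at hk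
  simp only [Bool.and_eq_true] at hk
  exact hk.1.2

theorem swap_inv (T : ℕ → ℕ → Bool) (n v w : ℕ) (hv : v < n) (hw : w < n) (hs : ∀ x y, x < n → y < n → T x y = T y x)
    (ht : ∀ j, j < n → j ≠ v → j ≠ w → T w j = T v j) (x y : ℕ) (hx : x < n) (hy : y < n) (hxy : x ≠ y) :
    T (Equiv.swap v w x) (Equiv.swap v w y) = T x y := by
  rcases eq_or_ne x v with rfl | h1
  · rw [Equiv.swap_apply_left]
    rcases eq_or_ne y w with rfl | h3
    · rw [Equiv.swap_apply_right]; exact hs _ _ hy hx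
    · rw [Equiv.swap_apply_of_ne_of_ne (Ne.symm hxy) h3]; exact ht y hy (Ne.symm hxy) h3
  rcases eq_or_ne x w with rfl | h2
  · rw [Equiv.swap_apply_right]
    rcases eq_or_ne y v with rfl | h3
    · rw [Equiv.swap_apply_left]; exact hs _ _ hy hx
    · rw [Equiv.swap_apply_of_ne_of_ne h3 (Ne.symm hxy)]; exact (ht y hy h3 (Ne.symm hxy)).symm
  rw [Equiv.swap_apply_of_ne_of_ne h1 h2]
  rcases eq_or_ne y v with rfl | h3
  · rw [Equiv.swap_apply_left, hs _ _ hx hw, hs _ _ hx hy]; exact ht x hx h1 h2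
  rcases eq_or_ne y w with rfl | h4
  · rw [Equiv.swap_apply_right, hs _ _ hx hv, hs _ _ hx hy]; exact (ht x hx h1 h2).symm
  rw [Equiv.swap_apply_of_ne_of_ne h3 h4]

def ClsOK (c : Cfg) (n C : ℕ) : Prop := ∀ x y, x < n → y < n → (∀ j, 26 ≤ j → j < 31 → C.testBit (32 * x + j) = C.testBit (32 * y + j)) →
  row c.D x = row c.D y ∧ row c.K x = row c.K y ∧ c.M.testBit x = c.M.testBit y

theorem swap_lt {n v w : ℕ} (hv : v < n) (hw : w < n) (x : ℕ) : Equiv.swap v w x < n ↔ x < n := by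
  rw [Equiv.swap_apply_def]; split_ifs <;> omega

theorem swap_card (Q : ℕ → Prop) [DecidablePred Q] {n v w : ℕ} (hv : v < n) (hw : w < n) :
    ((Finset.range n).filter (fun y => Q (Equiv.swap v w y))).card = ((Finset.range n).filter Q).card := by
  apply Finset.card_bij (fun y _ => Equiv.swap v w y)
  · intro a ha
    simp only [Finset.mem_filter, Finset.mem_range] at ha ⊢
    exact ⟨(swap_lt hv hw _).2 ha.1, ha.2⟩
  · intro a _ b _ hab; exact (Equiv.swap v w).injective hab
  · intro b hb
    simp only [Finset.mem_filter, Finset.mem_range] at hb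
    refine ⟨Equiv.swap v w b, ?_, by simp⟩
    simp only [Finset.mem_filter, Finset.mem_range, Equiv.swap_apply_self]
    exact ⟨(swap_lt hv hw _).2 hb.1, hb.2⟩

theorem Valid_swap (V : Valid c n P) {v w : ℕ} (hv : v < n) (hw : w < n) (hD : row c.D v = row c.D w)
    (hK : row c.K v = row c.K w) (hM : c.M.testBit v = c.M.testBit w) :
    Valid c n (fun x y => P (Equiv.swap v w x) (Equiv.swap v w y)) where
  lt := fun x y hxy => by
    have := V.lt _ _ hxy
    rwa [swap_lt hv hw, swap_lt hv hw] at this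
  irr := fun x => V.irr _
  sym := fun x y => V.sym _ _
  tri := fun a b d => V.tri _ _ _
  quad := fun a b d e h1 h2 h3 h4 => by
    have := V.quad _ _ _ _ h1 h2 h3 h4
    simpa using this
  deg := fun x => by
    have := swap_card (fun y => P (Equiv.swap v w x) y = true) hv hw
    rw [this, V.deg]
    rw [Equiv.swap_apply_def]; split_ifs with h1 h2
    · rw [h1, hD]
    · rw [h2, hD]
    · rfl
  cap := fun x => by
    have h1 : ∀ y, c.M.testBit y = c.M.testBit (Equiv.swap v w y) := by
      intro y
      rw [Equiv.swap_apply_def]; split_ifs with h1 h2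
      · rw [h1, hM]
      · rw [h2, hM]
      · rfl
    have h3 : row c.K x = row c.K (Equiv.swap v w x) := by
      rw [Equiv.swap_apply_def]; split_ifs with h1 h2
      · rw [h1, hK]
      · rw [h2, hK]
      · rfl
    have h2 : ((Finset.range n).filter (fun y => P (Equiv.swap v w x) (Equiv.swap v w y) = true ∧ c.M.testBit y = true)) =
      ((Finset.range n).filter (fun y => P (Equiv.swap v w x) (Equiv.swap v w y) = true ∧ c.M.testBit (Equiv.swap v w y) = true)) := by
      apply Finset.filter_congr
      intro y _
      rw [h1 y]
    rw [h2, h3]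
    have := swap_card (fun y => P (Equiv.swap v w x) y = true ∧ c.M.testBit y = true) hv hw
    rw [this]
    exact V.cap _

theorem Inv_swap (h : OK c n) (V : Valid c n P) (I : Inv n C P E A) {v w : ℕ} (hv : v < n) (hw : w < n)
    (ht : ∀ j, j < 31 → j ≠ v → j ≠ w → E.testBit (32 * w + j) = E.testBit (32 * v + j) ∧ A.testBit (32 * w + j) = A.testBit (32 * v + j)) :
    Inv n C (fun x y => P (Equiv.swap v w x) (Equiv.swap v w y)) E A := by
  have hn := h.hn
  have hE := swap_inv (fun x y => E.testBit (32 * x + y)) n v w hv hw (fun x y hx hy => by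
    rw [Bool.eq_iff_iff]; exact ⟨I.es _ _ (by omega) (by omega), I.es _ _ (by omega) (by omega)⟩)
    (fun j hj h1 h2 => (ht j (by omega) h1 h2).1)
  have hA := swap_inv (fun x y => A.testBit (32 * x + y)) n v w hv hw (fun x y hx hy => by
    rw [Bool.eq_iff_iff]; exact ⟨I.as _ _ (by omega) (by omega), I.as _ _ (by omega) (by omega)⟩)
    (fun j hj h1 h2 => (ht j (by omega) h1 h2).2)
  refine ⟨?_, I.es, I.as, ?_, I.cl⟩
  · intro k hk
    have h1 := I.e1 k hk
    obtain ⟨h2, h3⟩ := V.lt _ _ h1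
    have h4 : k / 32 ≠ k % 32 := by intro e; rw [e] at h1; exact V.irr _ h1
    have := hE (k / 32) (k % 32) h2 h3 h4
    simp only [show 32 * (k / 32) + k % 32 = k by omega, hk] at this
    have h5 := (swap_lt hv hw (k % 32)).2 h3
    exact e_P I (by omega) this
  · intro x y hxy
    have h1 := V.lt _ _ hxy
    rw [swap_lt hv hw, swap_lt hv hw] at h1
    have h4 : x ≠ y := by intro e; rw [e] at hxy; exact V.irr _ hxy
    have h2 := I.cov _ _ hxy
    have h5 := hE x y h1.1 h1.2 h4
    have h6 := hA x y h1.1 h1.2 h4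
    rwa [h5, h6] at h2

theorem Inv_forbT (h : OK c n) (hC : ClsOK c n C) (V : Valid c n P) (I : Inv n C P E A) {u v : ℕ} (hu : u < n) (hv : v < n) (huv : u ≠ v)
    (hno : ∀ P', Valid c n P' → Inv n C P' E A → ¬ P' u v = true) : Inv n C P E (forbT c E A u v) := by
  have hn := h.hn
  have key : ∀ w, (twins c E A u v).testBit (32 * w) = true → w < n ∧ ¬ P u w = true := by
    intro w hw
    obtain ⟨h1, h2⟩ := tb_twins h V I hv hw
    refine ⟨h1, fun hP => ?_⟩
    have hc := hC v w hv h1 (by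
      intro j hj hj'
      rw [← I.cl v j hv hj hj', ← I.cl w j h1 hj hj']
      exact (h2 j hj' (by omega) (by omega)).2.symm)
    refine hno _ (Valid_swap V hv h1 hc.1 hc.2.1 hc.2.2) (Inv_swap h V I hv h1 h2) ?_
    have : u ≠ w := by rintro rfl; exact V.irr _ hP
    simp only [Equiv.swap_apply_left, Equiv.swap_apply_of_ne_of_ne huv this]
    exact hP
  have htb : ∀ x y, y < 32 → ((Nat.lor (Nat.shiftLeft (twins c E A u v) u) (Nat.shiftLeft (c2r (twins c E A u v)) (Nat.mul 32 u))).testBit (32 * x + y) = true ↔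
      (y = u ∧ (twins c E A u v).testBit (32 * x) = true) ∨ (x = u ∧ (twins c E A u v).testBit (32 * y) = true)) := by
    intro x y hy
    rw [tb_lor, Bool.or_eq_true, tb_rowshl _ _ _ _ hy, tb_colshl _ _ _ _ hy (by omega) (isCol_of h (twins_col h u v)), tb_c2r' h (twins_col h u v)]
    intro j hj
    rw [tb_c2r' h (twins_col h u v)] at hj
    have := (key j hj).1
    omega
  unfold forbT
  apply Inv_sub h V I
  · intro x y hx hy
    rw [htb x y (by omega), htb y x (by omega)]
    tauto
  · intro x j hj
    rw [htb x j hj]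
    rintro (⟨rfl, _⟩ | ⟨_, hh⟩)
    · exact hu
    · exact (key _ hh).1
  · intro x y hxy
    have := V.lt _ _ hxy
    rw [htb x y (by omega)]
    rintro (⟨rfl, hh⟩ | ⟨rfl, hh⟩)
    · exact ((key _ hh).2 (V.sym _ _ hxy)).elim
    · exact ((key _ hh).2 hxy).elim

theorem search_sound (h : OK c n) (hC : ClsOK c n C) (fuel : ℕ) : ∀ E A, search c fuel E A = true → ∀ P, Valid c n P → Inv n C P E A → False := by
  have hn := h.hn
  induction fuel with
  | zero => intro E A hs; exact absurd hs (by simp [search])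
  | succ f ih =>
    intro E A hs P V I
    have hs : (fun AV U ND => 
      frc (pickU c E AV U ND) fun u0 =>
      frc (Nat.land u0 63) fun u =>
      frc (row AV u) fun a =>
      ife (ife (Nat.ble 64 u0) true (Nat.beq a 0))
        (Nat.rec false (fun d _ => cover E (row E c.R) u d (Nat.lor (row E u) a)) (row c.D u))
        (frc (pickV E (row E c.R) a U) fun v =>
         ife (Nat.beq (Nat.land (sub a (bt u)) (bt v)) 0) false
         (ife (frcS (addE E u v) fun E1 => frcS (addA c E E1 A u v) fun A1 => search c f E1 A1)
           (frcS (forbT c E A u v) fun A' => search c f E A') false)))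
       (Nat.land A c.all) (c2r (nz c (Nat.land E (Nat.mul c.col (row E c.R))))) (Nat.sub c.D (spc c E)) = true := hs
    simp only [frc_eq, frcS_eq] at hs
    generalize (c2r (nz c (Nat.land E (Nat.mul c.col (row E c.R))))) = U at hs
    generalize pickU c E (Nat.land A c.all) U (Nat.sub c.D (spc c E)) = u0 at hs
    generalize Nat.land u0 63 = u at hs
    generalize hv : pickV E (row E c.R) (row (Nat.land A c.all) u) U = v at hs
    rw [ife_eq] at hs
    split_ifs at hs with h1
    · have hd := V.deg u
      cases hdu : row c.D u with
      | zero => rw [hdu] at hs; simp at hs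
      | succ d =>
        rw [hdu] at hs hd
        have hs : cover E (row E c.R) u d (Nat.lor (row E u) (row (Nat.land A c.all) u)) = true := hs
        have := cover_sound h V I _ _ _ _ hs ((Finset.range n).filter (fun y => P u y = true)) (by
          intro y hy
          simp only [Finset.mem_filter] at hy
          refine ⟨hy.2, ?_⟩
          have h2 := V.lt _ _ hy.2
          have h3 : y < 32 := by omega
          rw [tb_lor, tb_row, tb_row, tb_land, h.all _ _ h3]
          rcases I.cov _ _ hy.2 with h4 | h4
          · simp [h4, h3]
          · simp [h4, h2.1, h2.2, h3])
        omega
    · rw [ife_eq, ife_eq] at hs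
      split_ifs at hs with h2 h3
      have h4 : (Nat.land (sub (row (Nat.land A c.all) u) (bt u)) (bt v)) ≠ 0 := by simpa using h2
      have h5 : (sub (row (Nat.land A c.all) u) (bt u)).testBit v = true := by
        by_contra hcon
        apply h4
        apply Nat.eq_of_testBit_eq
        intro j
        rw [tb_land, tb_bt]
        by_cases hj : v = j
        · subst hj; rw [Bool.eq_false_iff.2 hcon]; simp
        · simp [hj]
      rw [tb_sub, tb_row, tb_land, tb_bt] at h5
      simp only [Bool.and_eq_true, decide_eq_true_eq, Bool.not_eq_true', decide_eq_false_iff_not] at h5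
      obtain ⟨⟨h6, h7, h8⟩, h9⟩ := h5
      rw [h.all _ _ h6] at h8
      simp at h8
      have hno : ∀ P', Valid c n P' → Inv n C P' E A → ¬ P' u v = true := by
        intro P' V' I' hP'
        exact ih _ _ h3 P' V' (Inv_addA h V' I' hP')
      exact ih _ _ hs P V (Inv_forbT h hC V I h8.1 h8.2 h9 hno)

theorem init_sound (h : OK c n) (hC : ClsOK c n C) (fuel : ℕ) (V : Valid c n P) (ed : List (ℕ × ℕ)) : ∀ E A, initE c (search c fuel) ed E A = true →
    (∀ p ∈ ed, P p.1 p.2 = true) → Inv n C P E A → False := by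
  induction ed with
  | nil => intro E A hs _ I; exact search_sound h hC fuel E A hs P V I
  | cons p l ih =>
    intro E A hs hp I
    have hs : (frcS (addE E p.1 p.2) fun E1 => frcS (addA c E E1 A p.1 p.2) fun A1 => initE c (search c fuel) l E1 A1) = true := hs
    simp only [frcS_eq] at hs
    exact ih _ _ hs (fun q hq => hp q (List.mem_cons_of_mem _ hq)) (Inv_addA h V I (hp p List.mem_cons_self))
end
end TS

namespace TS
theorem tb_diag (n k : ℕ) : (diag n).testBit k = true ↔ ∃ m, m < n ∧ k = 33 * m := by
  induction n with
  | zero => simp [diag]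
  | succ n ih =>
    show (Nat.lor (diag n) (bt (Nat.mul 33 n))).testBit k = true ↔ _
    rw [tb_lor, Bool.or_eq_true, ih, tb_bt]
    show _ ∨ decide (33 * n = k) = true ↔ _
    rw [decide_eq_true_eq]
    constructor
    · rintro (⟨m, h1, h2⟩ | h)
      · exact ⟨m, by omega, h2⟩
      · exact ⟨n, by omega, h.symm⟩
    · rintro ⟨m, h1, h2⟩
      rcases Nat.lt_succ_iff_lt_or_eq.1 h1 with h | h
      · left; exact ⟨m, h, h2⟩
      · right; subst h; exact h2.symm
theorem tb_bitsOf (l : List ℕ) (k : ℕ) : (bitsOf l).testBit k = true ↔ k ∈ l := by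
  induction l with
  | nil => simp [bitsOf]
  | cons a l ih =>
    show (Nat.lor (bt a) (bitsOf l)).testBit k = true ↔ _
    rw [tb_lor, Bool.or_eq_true, ih, tb_bt, List.mem_cons, decide_eq_true_eq, eq_comm]
theorem tb_colOf (l : List ℕ) (i j : ℕ) (hj : j < 32) : (colOf l).testBit (32 * i + j) = true ↔ j = 0 ∧ i ∈ l := by
  induction l with
  | nil => simp [colOf]
  | cons a l ih =>
    show (Nat.lor (bt (32 * a)) (colOf l)).testBit _ = true ↔ _
    rw [tb_lor, Bool.or_eq_true, ih, tb_bt, List.mem_cons, decide_eq_true_eq]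
    constructor
    · rintro (h | h)
      · exact ⟨by omega, Or.inl (by omega)⟩
      · exact ⟨h.1, Or.inr h.2⟩
    · rintro ⟨h, h' | h'⟩
      · left; omega
      · right; exact ⟨h, h'⟩
theorem row_pack (l : List ℕ) : (∀ a ∈ l, a < 4294967296) → ∀ x, row (pack l) x = l.getD x 0 := by
  have hrow : ∀ X i, row X i = X / 2 ^ (32 * i) % 2 ^ 32 := by
    intro X i
    show (X >>> (32 * i)) &&& (2 ^ 32 - 1) = _
    rw [Nat.and_two_pow_sub_one_eq_mod, Nat.shiftRight_eq_div_pow]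
  induction l with
  | nil => intro _ x; rw [hrow]; simp [pack]
  | cons a l ih =>
    intro hl x
    have ha := hl a List.mem_cons_self
    have ih := ih (fun b hb => hl b (List.mem_cons_of_mem _ hb))
    rw [hrow]
    show (a + 4294967296 * pack l) / _ % _ = _
    cases x with
    | zero => simp; omega
    | succ x =>
      rw [List.getD_cons_succ, ← ih x, hrow, show 32 * (x + 1) = 32 + 32 * x by ring, pow_add, ← Nat.div_div_eq_div_mul]
      congr 2
      omega

theorem OK_mk (n R : ℕ) (pri D M K : List ℕ) (hn : n ≤ 26) (hM : ∀ j ∈ M, j < n) : OK (mkCfg n R pri D M K) n := by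
  have hb : Nat.pred (bt n) = 2 ^ n - 1 := by
    show (1 <<< n) - 1 = _; rw [Nat.one_shiftLeft]
  have h26 : 2 ^ n ≤ 2 ^ 26 := Nat.pow_le_pow_right (by norm_num) hn
  refine ⟨hn, rfl, rep_mul _ _, ?_, ?_, ?_, ?_, ?_, ?_⟩
  · intro j
    show (Nat.pred (bt n)).testBit j = _
    rw [hb, Nat.testBit_two_pow_sub_one]
  · intro i j hj
    show (Nat.mul (rep n 1) (Nat.pred (bt n))).testBit _ = _
    rw [rep_mul, tb_rep _ (by rw [hb]; omega) j hj, hb, Nat.testBit_two_pow_sub_one]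
  · intro i j hj hi hij
    show (sub (Nat.mul (rep n 1) 2147483647) (diag n)).testBit _ = _
    rw [tb_sub, rep_mul, tb_rep _ (by norm_num) j (by omega), show 2147483647 = 2 ^ 31 - 1 by norm_num, Nat.testBit_two_pow_sub_one]
    have : (diag n).testBit (32 * i + j) = false := by
      rw [← Bool.not_eq_true, tb_diag]
      rintro ⟨m, h1, h2⟩
      omega
    simp [hi, hj, this]
  · intro k hk
    have hk : (sub (Nat.mul (rep n 1) 2147483647) (diag n)).testBit k = true := hk
    rw [tb_sub, rep_mul, show k = 32 * (k / 32) + k % 32 by omega, tb_rep _ (by norm_num) _ (by omega), show 2147483647 = 2 ^ 31 - 1 by norm_num, Nat.testBit_two_pow_sub_one] at hk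
    simp at hk
    omega
  · intro j hj
    exact hM j ((tb_bitsOf M j).1 hj)
  · intro i j hj
    show (colOf M).testBit _ = (_ && (bitsOf M).testBit i)
    rw [Bool.eq_iff_iff, tb_colOf M i j hj]
    simp [tb_bitsOf]

def chk (n C : ℕ) (D M K : List ℕ) : Bool :=
  (M.all fun j => decide (j < n)) && (D.all fun a => decide (a < 4294967296)) && (K.all fun a => decide (a < 4294967296)) && decide (D.length = n) && decide (Nat.land C (rep n 31) = C) &&
  (List.range n).all fun x => (List.range n).all fun y => 
    !(decide ((C >>> (32 * x)) % 32 = (C >>> (32 * y)) % 32)) || (decide (D.getD x 0 = D.getD y 0) && decide (K.getD x 0 = K.getD y 0) && (decide (x ∈ M) == decide (y ∈ M)))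

theorem run_sound {n R C : ℕ} {pri D M K : List ℕ} {ed : List (ℕ × ℕ)} (hrun : run (mkCfg n R pri D M K) n C ed = true)
    (hchk : chk n C D M K = true) (hn : n ≤ 26)
    (P : ℕ → ℕ → Bool)
    (lt : ∀ x y, P x y = true → x < n ∧ y < n)
    (irr : ∀ x, ¬ P x x = true)
    (sym : ∀ x y, P x y = true → P y x = true)
    (tri : ∀ a b d, P a b = true → P b d = true → P a d = true → False)
    (quad : ∀ a b d e, P a b = true → P b d = true → P d e = true → P e a = true → a = d ∨ b = e)
    (deg : ∀ x, x < n → ((Finset.range n).filter (fun y => P x y = true)).card = D.getD x 0)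
    (cap : ∀ x, x < n → ((Finset.range n).filter (fun y => P x y = true ∧ y ∈ M)).card ≤ K.getD x 0)
    (hed : ∀ p ∈ ed, P p.1 p.2 = true) : False := by
  unfold chk at hchk
  simp only [Bool.and_eq_true, List.all_eq_true, decide_eq_true_eq, List.mem_range] at hchk
  obtain ⟨⟨⟨⟨⟨hM, hD⟩, hK⟩, hlen⟩, hCl⟩, hcl⟩ := hchk
  have h := OK_mk n R pri D M K hn hM
  set c := mkCfg n R pri D M K with hc
  have rD : ∀ x, row c.D x = D.getD x 0 := row_pack D hD
  have rK : ∀ x, row c.K x = K.getD x 0 := row_pack K hK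
  have rM : ∀ x, c.M.testBit x = true ↔ x ∈ M := tb_bitsOf M
  have hno : ∀ x, ¬ x < n → ∀ y, ¬ P x y = true := fun x hx y hxy => hx (lt _ _ hxy).1
  have V : Valid c n P := by
    refine ⟨lt, irr, sym, tri, quad, ?_, ?_⟩
    · intro x
      rw [rD]
      by_cases hx : x < n
      · exact deg x hx
      · rw [Finset.filter_false_of_mem (fun y _ => hno x hx y), List.getD_eq_default _ _ (by omega)]; rfl
    · intro x
      rw [rK]
      simp only [rM]
      by_cases hx : x < n
      · exact cap x hx
      · rw [Finset.filter_false_of_mem (fun y _ hh => hno x hx y hh.1)]; exact Nat.zero_le _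
  have hA : ∀ x y, y < 32 → (Nat.lor (sub c.all (diag n)) (Nat.shiftLeft C 26)).testBit (32 * x + y) = 
      ((decide (x < n) && decide (y < n) && !decide (x = y)) || (decide (32 * x + y ≥ 26) && C.testBit (32 * x + y - 26))) := by
    intro x y hy
    rw [tb_lor, tb_sub, h.all _ _ hy, tb_shl]
    by_cases hx : x < n
    · by_cases hy' : y < n
      · have : (diag n).testBit (32 * x + y) = decide (x = y) := by
          rw [Bool.eq_iff_iff, tb_diag, decide_eq_true_eq]
          constructor
          · rintro ⟨m, h1, h2⟩; omega
          · rintro rfl; exact ⟨x, hx, by omega⟩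
        rw [this]
      · simp [hy']
    · simp [hx]
  generalize hG : Nat.lor (sub c.all (diag n)) (Nat.shiftLeft C 26) = A at hA
  have hrun : initE c (search c 200) ed 0 A = true := by rw [← hG]; exact hrun
  have hC5 : ∀ k, C.testBit k = true → k % 32 < 5 := by
    intro k hk
    rw [← hCl, tb_land, show k = 32 * (k / 32) + k % 32 by omega, tb_rep _ (by norm_num) _ (by omega), show 31 = 2 ^ 5 - 1 by norm_num, Nat.testBit_two_pow_sub_one] at hk
    simp at hk
    exact hk.2.2
  have hA' : ∀ x y, x < n → y < n → (A.testBit (32 * x + y) = true ↔ x ≠ y) := by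
    intro x y hx hy
    rw [hA x y (by omega)]
    have : (decide (32 * x + y ≥ 26) && C.testBit (32 * x + y - 26)) = false := by
      rw [← Bool.not_eq_true]
      intro hh
      simp at hh
      have := hC5 _ hh.2
      omega
    rw [this]
    simp [hx, hy]
  have I : Inv n A P 0 A := by
    refine ⟨?_, ?_, ?_, ?_, ?_⟩
    · intro k hk; simp at hk
    · intro x y _ _ hk; simp at hk
    · intro x y hx hy
      rw [hA' x y hx hy, hA' y x hy hx]
      exact Ne.symm
    · intro x y hxy
      right
      rw [hA' x y (lt _ _ hxy).1 (lt _ _ hxy).2]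
      rintro rfl
      exact irr _ hxy
    · intros; rfl
  refine init_sound h ?_ 200 V ed 0 A hrun hed I
  intro x y hx hy hj
  have hk : (C >>> (32 * x)) % 32 = (C >>> (32 * y)) % 32 := by
    rw [show 32 = 2 ^ 5 by norm_num]
    apply Nat.eq_of_testBit_eq
    intro j
    rw [Nat.testBit_mod_two_pow, Nat.testBit_mod_two_pow, Nat.testBit_shiftRight, Nat.testBit_shiftRight]
    by_cases h5 : j < 5
    · have h1 := hj (26 + j) (by omega) (by omega)
      rw [hA x _ (by omega), hA y _ (by omega)] at h1
      rw [show 32 * x + (26 + j) - 26 = 32 * x + j by omega, show 32 * y + (26 + j) - 26 = 32 * y + j by omega] at h1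
      have e1 : ¬ (26 + j < n) := by omega
      have e2 : 32 * x + (26 + j) ≥ 26 := by omega
      have e3 : 32 * y + (26 + j) ≥ 26 := by omega
      simp only [e1, e2, e3, decide_true, decide_false, Bool.and_false, Bool.false_and, Bool.false_or, Bool.true_and] at h1
      rw [show 2 ^ 5 = 32 by norm_num, h1]
    · simp [h5]
  have := hcl x hx y hy
  rw [hk] at this
  simp at this
  rw [rD, rD, rK, rK]
  refine ⟨by simpa using this.1.1, by simpa using this.1.2, ?_⟩
  rw [Bool.eq_iff_iff, rM, rM]
  exact this.2
end TS

namespace TS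
section
variable {V : Type} [DecidableEq V] (G : SimpleGraph V) [DecidableRel G.Adj]

structure G5 : Prop where
  tri : ∀ a b d, G.Adj a b → G.Adj b d → G.Adj a d → False
  quad : ∀ a b d e, G.Adj a b → G.Adj b d → G.Adj d e → G.Adj e a → a = d ∨ b = e

/-- number of neighbours of `x` in `T` -/
def dg (T : Finset V) (x : V) : ℕ := (T.filter (fun y => G.Adj x y)).card
/-- twice the number of edges -/
def es (S : Finset V) : ℕ := ∑ x ∈ S, dg G S x

theorem dg_sum (T : Finset V) (x : V) : dg G T x = ∑ y ∈ T, if G.Adj x y then 1 else 0 := by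
  unfold dg; rw [Finset.card_filter]

theorem dg_dc (S T : Finset V) : ∑ z ∈ S, dg G T z = ∑ a ∈ T, dg G S a := by
  simp only [dg_sum]
  rw [Finset.sum_comm]
  simp only [G.adj_comm]

theorem dg_split (S : Finset V) (p : V → Prop) [DecidablePred p] (x : V) :
    dg G S x = dg G (S.filter p) x + dg G (S.filter (fun y => ¬ p y)) x := by
  simp only [dg_sum]
  rw [Finset.sum_filter_add_sum_filter_not]

theorem dg_mono {S T : Finset V} (h : S ⊆ T) (x : V) : dg G S x ≤ dg G T x :=
  Finset.card_le_card (Finset.filter_subset_filter _ h)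

theorem dg_erase (S : Finset V) (v x : V) (hv : v ∈ S) : dg G S x = dg G (S.erase v) x + if G.Adj x v then 1 else 0 := by
  simp only [dg_sum]
  rw [Finset.sum_erase_add _ _ hv]

theorem es_erase (S : Finset V) (v : V) (hv : v ∈ S) : es G S = es G (S.erase v) + 2 * dg G S v := by
  unfold es
  rw [← Finset.sum_erase_add _ _ hv]
  rw [Finset.sum_congr rfl (fun x _ => dg_erase G S v x hv), Finset.sum_add_distrib]
  have : dg G S v = ∑ x ∈ S.erase v, if G.Adj x v then 1 else 0 := by
    rw [dg_sum, ← Finset.sum_erase_add _ _ hv]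
    simp [G.adj_comm]
  omega

theorem es_even (S : Finset V) : ∃ k, es G S = 2 * k := by
  induction S using Finset.induction_on with
  | empty => exact ⟨0, rfl⟩
  | insert a S ha ih =>
    obtain ⟨k, hk⟩ := ih
    have := es_erase G (insert a S) a (Finset.mem_insert_self _ _)
    rw [Finset.erase_insert ha, hk] at this
    exact ⟨k + dg G (insert a S) a, by omega⟩

variable {G}
theorem pair_lemma (h : G5 G) (S T : Finset V) :
    ∑ z ∈ S, dg G T z * dg G T z + ∑ z ∈ T, dg G T z ≤ T.card * (T.card - 1) + ∑ z ∈ S, dg G T z := by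
  have h1 : ∑ z ∈ S, dg G T z * dg G T z = ∑ a ∈ T, ∑ b ∈ T, ∑ z ∈ S, (if G.Adj z a then 1 else 0) * (if G.Adj z b then 1 else 0) := by
    simp only [dg_sum, Finset.sum_mul_sum]
    rw [Finset.sum_comm]
    refine Finset.sum_congr rfl (fun a _ => ?_)
    rw [Finset.sum_comm]
  have h2 : ∑ z ∈ T, dg G T z = ∑ a ∈ T, ∑ b ∈ T, if G.Adj a b then 1 else 0 := by
    simp only [dg_sum]
  have h3 : ∑ z ∈ S, dg G T z = ∑ a ∈ T, ∑ b ∈ T, if a = b then dg G S a else 0 := by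
    rw [dg_dc]
    refine Finset.sum_congr rfl (fun a ha => ?_)
    rw [Finset.sum_ite_eq]; simp [ha]
  have h4 : T.card * (T.card - 1) = ∑ a ∈ T, ∑ b ∈ T, if a = b then 0 else 1 := by
    have : ∀ a ∈ T, (∑ b ∈ T, if a = b then 0 else 1) = T.card - 1 := by
      intro a ha
      rw [← Finset.card_erase_of_mem ha, Finset.card_eq_sum_ones, ← Finset.sum_erase_add _ _ ha]
      simp only [if_true, add_zero]
      refine Finset.sum_congr rfl (fun b hb => ?_)
      rw [if_neg (Ne.symm (Finset.ne_of_mem_erase hb))]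
    rw [Finset.sum_congr rfl this]; simp
  rw [h1, h2, h3, h4, ← Finset.sum_add_distrib, ← Finset.sum_add_distrib]
  refine Finset.sum_le_sum (fun a _ => ?_)
  rw [← Finset.sum_add_distrib, ← Finset.sum_add_distrib]
  refine Finset.sum_le_sum (fun b _ => ?_)
  by_cases hab : a = b
  · subst hab
    simp only [if_true, G.irrefl, if_false, add_zero, zero_add]
    rw [dg_sum]
    refine Finset.sum_le_sum (fun z _ => ?_)
    by_cases hz : G.Adj z a
    · simp [hz, hz.symm]
    · simp [hz]
  · simp only [hab, if_false, add_zero]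
    have hc : (∑ z ∈ S, (if G.Adj z a then 1 else 0) * (if G.Adj z b then 1 else 0)) = (S.filter (fun z => G.Adj z a ∧ G.Adj z b)).card := by
      rw [Finset.card_filter]
      refine Finset.sum_congr rfl (fun z _ => ?_)
      by_cases h1 : G.Adj z a <;> by_cases h2 : G.Adj z b <;> simp [h1, h2]
    rw [hc]
    by_cases hA : G.Adj a b
    · rw [if_pos hA, Finset.filter_false_of_mem]
      · simp
      · rintro z _ ⟨h1, h2⟩; exact h.tri _ _ _ h1 hA h2
    · rw [if_neg hA, add_zero, Finset.card_le_one]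
      intro x hx y hy
      rw [Finset.mem_filter] at hx hy
      rcases h.quad a x b y hx.2.1.symm hx.2.2 hy.2.2.symm hy.2.1 with e | e
      · exact (hab e).elim
      · exact e

/-- vertices of `S` at distance at least 3 from `x` -/
def far (G : SimpleGraph V) [DecidableRel G.Adj] (S : Finset V) (x : V) : Finset V :=
  S.filter (fun z => z ≠ x ∧ ¬ G.Adj x z ∧ ∀ y ∈ S, G.Adj x y → ¬ G.Adj y z)

theorem ball_eq (h : G5 G) (S : Finset V) (x : V) (hx : x ∈ S) :
    ∑ y ∈ S.filter (fun y => G.Adj x y), dg G S y + (far G S x).card + 1 = S.card := by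
  rw [← dg_dc]
  have key : ∀ z ∈ S, dg G (S.filter (fun y => G.Adj x y)) z + (if z ∈ far G S x then 1 else 0) + (if z = x then 1 else 0) + (if G.Adj x z then 1 else 0) = 1 + if z = x then dg G S x else 0 := by
    intro z hz
    by_cases hzx : z = x
    · subst hzx
      have : z ∉ far G S z := by simp [far]
      simp only [this, if_false, if_true, G.irrefl, add_zero]
      rw [dg, Finset.filter_filter]; simp only [and_self]; rw [dg]; omega
    · simp only [hzx, if_false, add_zero]
      by_cases hA : G.Adj x z
      · have : z ∉ far G S x := by simp [far, hA]
        rw [if_neg this, if_pos hA, dg, Finset.filter_false_of_mem]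
        · simp
        · intro y hy hzy
          rw [Finset.mem_filter] at hy
          exact h.tri _ _ _ hA hzy hy.2
      · rw [if_neg hA]
        by_cases hf : z ∈ far G S x
        · rw [if_pos hf, dg, Finset.filter_false_of_mem]
          · simp
          · intro y hy hzy
            rw [Finset.mem_filter] at hy
            simp only [far, Finset.mem_filter] at hf
            exact hf.2.2.2 y hy.1 hy.2 hzy.symm
        · rw [if_neg hf]
          simp only [far, Finset.mem_filter] at hf
          push Not at hf
          obtain ⟨y, hy, h1, h2⟩ := hf hz hzx hA
          simp only [add_zero]
          rw [dg, Finset.card_eq_one]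
          refine ⟨y, ?_⟩
          ext w
          simp only [Finset.mem_filter, Finset.mem_singleton]
          constructor
          · rintro ⟨⟨h3, h4⟩, h5⟩
            rcases h.quad x y z w h1 h2 h5 h4.symm with e | e
            · exact (hzx e.symm).elim
            · exact e.symm
          · rintro rfl; exact ⟨⟨hy, h1⟩, h2.symm⟩
  have := Finset.sum_congr rfl key
  simp only [Finset.sum_add_distrib, Finset.sum_ite_eq', hx, if_true] at this
  rw [← dg_sum] at this
  have hf : (∑ z ∈ S, if z ∈ far G S x then 1 else 0) = (far G S x).card := by
    rw [← Finset.card_filter]; congr 1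
    ext z; simp only [Finset.mem_filter, far]; tauto
  rw [hf] at this
  simp at this
  omega

theorem ball (h : G5 G) (S : Finset V) (x : V) (hx : x ∈ S) (k : ℕ) (hk : ∀ y ∈ S, k ≤ dg G S y) : k * dg G S x + 1 ≤ S.card := by
  have := ball_eq h S x hx
  have h2 : dg G S x * k ≤ ∑ y ∈ S.filter (fun y => G.Adj x y), dg G S y := by
    unfold dg
    rw [← smul_eq_mul]
    exact Finset.card_nsmul_le_sum _ _ _ (fun y hy => hk y (Finset.mem_filter.1 hy).1)
  rw [mul_comm]
  omega
end
end TS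

namespace TS
section
variable {V : Type} [DecidableEq V] {G : SimpleGraph V} [DecidableRel G.Adj]

theorem relabel {n : ℕ} (S : Finset V) (f : V → ℕ) (D : ℕ → ℕ)
    (hcount : ∀ k, (S.filter (fun x => f x = k)).card = ((Finset.range n).filter (fun i => D i = k)).card)
    (L : List (ℕ × V)) (hn : ∀ p ∈ L, p.1 < n ∧ p.2 ∈ S ∧ f p.2 = D p.1)
    (h1 : (L.map Prod.fst).Nodup) (h2 : (L.map Prod.snd).Nodup) :
    ∃ e : Fin n ≃ S, (∀ i, f (e i) = D i) ∧ ∀ p ∈ L, ∀ h : p.1 < n, ((e ⟨p.1, h⟩ : S) : V) = p.2 := by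
  induction L with
  | nil =>
    have : ∀ k, Nonempty ({i : Fin n // D i = k} ≃ {x : S // f x = k}) := by
      intro k
      refine ⟨Fintype.equivOfCardEq ?_⟩
      have e1 : Fintype.card {i : Fin n // D i = k} = ((Finset.range n).filter (fun i => D i = k)).card := by
        rw [Fintype.card_subtype]
        apply Finset.card_bij (fun (i : Fin n) _ => (i : ℕ))
        · intro i hi; simp at hi ⊢; exact hi
        · intro i _ j _ hij; exact Fin.ext hij
        · intro j hj; simp at hj; exact ⟨⟨j, hj.1⟩, by simpa using hj.2, rfl⟩
      have e2 : Fintype.card {x : S // f x = k} = (S.filter (fun x => f x = k)).card := by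
        rw [Fintype.card_subtype]
        apply Finset.card_bij (fun (i : S) _ => (i : V))
        · intro i hi; simp at hi ⊢; exact hi
        · intro i _ j _ hij; exact Subtype.ext hij
        · intro j hj; simp at hj; exact ⟨⟨j, hj.1⟩, by simpa using hj.2, rfl⟩
      rw [e1, e2, hcount]
    refine ⟨Equiv.ofFiberEquiv (f := fun i : Fin n => D i) (g := fun x : S => f x) (fun k => (this k).some), ?_, by simp⟩
    intro i
    exact Equiv.ofFiberEquiv_map (f := fun i : Fin n => D i) (g := fun x : S => f x) _ i
  | cons p L ih =>
    simp only [List.map_cons, List.nodup_cons] at h1 h2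
    obtain ⟨e, he, hL⟩ := ih (fun q hq => hn q (List.mem_cons_of_mem _ hq)) h1.2 h2.2
    obtain ⟨hp1, hp2, hp3⟩ := hn p List.mem_cons_self
    set a : S := e ⟨p.1, hp1⟩ with ha
    set b : S := ⟨p.2, hp2⟩ with hb
    have hab : f a = f b := by rw [ha, he, hb]; exact hp3.symm
    refine ⟨e.trans (Equiv.swap a b), ?_, ?_⟩
    · intro i
      rw [Equiv.trans_apply, ← he i, Equiv.swap_apply_def]
      split_ifs with h3 h4
      · rw [h3, hab]
      · rw [h4, hab]
      · rfl
    · intro q hq h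
      rw [Equiv.trans_apply]
      rcases List.mem_cons.1 hq with rfl | hq'
      · rw [← ha, Equiv.swap_apply_left]
      · rw [Equiv.swap_apply_of_ne_of_ne]
        · exact hL q hq' h
        · rw [ha]; intro e'
          have := congrArg Fin.val (e.injective e')
          simp only at this
          exact h1.1 (this ▸ List.mem_map_of_mem hq')
        · intro e'
          have := hL q hq' h
          rw [e'] at this
          exact h2.1 ((show p.2 = q.2 from this) ▸ List.mem_map_of_mem hq')

def chk2 (n q : ℕ) (D M : List ℕ) : Bool :=
  (List.range n).all fun x => decide (D.getD x 0 < 8) && (decide (x ∈ M) == decide (D.getD x 0 = q))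

theorem finish {n R C q : ℕ} {pri D M K : List ℕ} {ed : List (ℕ × ℕ)} (hrun : run (mkCfg n R pri D M K) n C ed = true)
    (hchk : chk n C D M K = true) (hchk2 : chk2 n q D M = true) (hn : n ≤ 26) (h : G5 G) (S : Finset V)
    (hS8 : ∀ x ∈ S, dg G S x < 8)
    (hcount : ∀ k, k < 8 → (S.filter (fun x => dg G S x = k)).card = ((Finset.range n).filter (fun i => D.getD i 0 = k)).card)
    (L : List (ℕ × V)) (hL : ∀ p ∈ L, p.1 < n ∧ p.2 ∈ S ∧ dg G S p.2 = D.getD p.1 0)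
    (h1 : (L.map Prod.fst).Nodup) (h2 : (L.map Prod.snd).Nodup)
    (hed : ∀ p ∈ ed, ∃ a b, (p.1, a) ∈ L ∧ (p.2, b) ∈ L ∧ G.Adj a b)
    (hcap : ∀ i, i < n → ∀ v ∈ S, dg G S v = D.getD i 0 → (∀ p ∈ L, p.1 = i → v = p.2) → dg G (S.filter (fun x => dg G S x = q)) v ≤ K.getD i 0) : False := by
  unfold chk2 at hchk2
  simp only [Bool.and_eq_true, List.all_eq_true, decide_eq_true_eq, List.mem_range, beq_iff_eq, decide_eq_decide] at hchk2
  obtain ⟨e, he1, he2⟩ := relabel (n := n) S (dg G S) (fun i => D.getD i 0) (by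
    intro k
    by_cases hk : k < 8
    · exact hcount k hk
    · rw [Finset.filter_false_of_mem, Finset.filter_false_of_mem]
      · rfl
      · intro x hx; have := (hchk2 x (by simpa using hx)).1; omega
      · intro x hx; have := hS8 x hx; omega) L hL h1 h2
  let P : ℕ → ℕ → Bool := fun i j => if hi : i < n then if hj : j < n then decide (G.Adj (e ⟨i, hi⟩) (e ⟨j, hj⟩)) else false else false
  have hP : ∀ i j, P i j = true ↔ ∃ hi : i < n, ∃ hj : j < n, G.Adj (e ⟨i, hi⟩) (e ⟨j, hj⟩) := by
    intro i j
    simp only [P]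
    split_ifs with hi hj <;> simp [*]
  have hinj : ∀ i j (hi : i < n) (hj : j < n), ((e ⟨i, hi⟩ : S) : V) = e ⟨j, hj⟩ → i = j := by
    intro i j hi hj hh
    have := e.injective (Subtype.ext hh)
    simpa using this
  have hcard : ∀ (Q : V → Prop) [DecidablePred Q] (i : ℕ) (hi : i < n),
     ((Finset.range n).filter (fun y => P i y = true ∧ ∃ hy : y < n, Q (e ⟨y, hy⟩))).card = dg G (S.filter Q) (e ⟨i, hi⟩) := by
    intro Q _ i hi
    unfold dg
    symm
    apply Finset.card_bij' (fun x hx => ((e.symm ⟨x, (Finset.mem_filter.1 (Finset.mem_filter.1 hx).1).1⟩ : Fin n) : ℕ)) (fun j hj => ((e ⟨j, Finset.mem_range.1 (Finset.mem_filter.1 hj).1⟩ : S) : V))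
    · intro x hx; simp
    · intro x hx; simp
    · intro x hx
      simp only [Finset.mem_filter] at hx
      simp [hP, hi, hx]
    · intro j hj
      simp only [Finset.mem_filter, hP] at hj
      obtain ⟨h3, ⟨_, _, h4⟩, _, h5⟩ := hj
      simp [h4, h5]
  refine run_sound hrun hchk hn P ?_ ?_ ?_ ?_ ?_ ?_ ?_ ?_
  · intro x y hxy; rw [hP] at hxy; obtain ⟨a, b, _⟩ := hxy; exact ⟨a, b⟩
  · intro x hx; rw [hP] at hx; obtain ⟨a, b, hh⟩ := hx; exact G.irrefl hh
  · intro x y hxy; rw [hP] at hxy ⊢; obtain ⟨a, b, hh⟩ := hxy; exact ⟨b, a, hh.symm⟩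
  · intro x y z ha hb hc
    rw [hP] at ha hb hc
    obtain ⟨_, _, ha⟩ := ha
    obtain ⟨_, _, hb⟩ := hb
    obtain ⟨_, _, hc⟩ := hc
    exact h.tri _ _ _ ha hb hc
  · intro x y z w ha hb hc hd
    rw [hP] at ha hb hc hd
    obtain ⟨_, _, ha⟩ := ha
    obtain ⟨_, _, hb⟩ := hb
    obtain ⟨_, _, hc⟩ := hc
    obtain ⟨_, _, hd⟩ := hd
    rcases h.quad _ _ _ _ ha hb hc hd with e | e
    · left; exact hinj _ _ _ _ e
    · right; exact hinj _ _ _ _ e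
  · intro x hx
    have := hcard (fun _ => True) x hx
    rw [Finset.filter_true_of_mem (fun _ _ => trivial), he1 ⟨x, hx⟩] at this
    rw [← this]
    congr 1
    apply Finset.filter_congr
    intro y hy
    simp only [Finset.mem_range] at hy
    simp [hy]
  · intro x hx
    have := hcard (fun v => dg G S v = q) x hx
    have h3 := hcap x hx (e ⟨x, hx⟩) (e ⟨x, hx⟩).2 (he1 ⟨x, hx⟩) (by
      rintro p hp rfl
      exact he2 p hp hx)
    rw [← this] at h3
    refine le_trans (le_of_eq ?_) h3
    congr 1
    apply Finset.filter_congr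
    intro y hy
    simp only [Finset.mem_range] at hy
    rw [(hchk2 y hy).2]
    simp only [hy, exists_true_left, he1 ⟨y, hy⟩]
  · intro p hp
    obtain ⟨a, b, ha, hb, hab⟩ := hed p hp
    have h3 := (hL _ ha).1
    have h4 := (hL _ hb).1
    rw [hP]
    refine ⟨h3, h4, ?_⟩
    have h5 := he2 _ ha h3
    have h6 := he2 _ hb h4
    simp only at h5 h6
    rw [h5, h6]; exact hab
end
end TS

namespace TS
section
variable {V : Type} [DecidableEq V] {G : SimpleGraph V} [DecidableRel G.Adj]

/-- vertices of degree `k` -/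
def cl (G : SimpleGraph V) [DecidableRel G.Adj] (S : Finset V) (k : ℕ) : Finset V := S.filter (fun x => dg G S x = k)
theorem mem_cl {S : Finset V} {k : ℕ} {x : V} : x ∈ cl G S k ↔ x ∈ S ∧ dg G S x = k := Finset.mem_filter

def chk3 (n hi lo a b kh kl : ℕ) (D K : List ℕ) : Bool :=
  ((List.range 8).all fun k => decide (((List.range n).filter (fun i => decide (D.getD i 0 = k))).length = if k = hi then a else if k = lo then b else 0)) &&
  (List.range n).all fun i => (decide (i = 0) || decide (D.getD i 0 ≠ hi) || decide (kh ≤ K.getD i 0)) && (decide (D.getD i 0 ≠ lo) || decide (kl ≤ K.getD i 0)) && decide (D.getD i 0 = hi ∨ D.getD i 0 = lo)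

theorem finish2 {n R C hi lo q a b kh kl : ℕ} {pri D M K : List ℕ} {ed : List (ℕ × ℕ)} (hrun : run (mkCfg n R pri D M K) n C ed = true)
    (hchk : chk n C D M K = true) (hchk2 : chk2 n q D M = true) (hchk3 : chk3 n hi lo a b kh kl D K = true)
    (hn : n ≤ 26) (hhi : hi < 8) (hlo : lo < 8) (h : G5 G) (S : Finset V)
    (hS : ∀ x ∈ S, dg G S x = hi ∨ dg G S x = lo)
    (ha : (cl G S hi).card = a) (hb : (cl G S lo).card = b)
    (L : List (ℕ × V)) (hL : ∀ p ∈ L, p.1 < n ∧ p.2 ∈ S ∧ dg G S p.2 = D.getD p.1 0)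
    (h1 : (L.map Prod.fst).Nodup) (h2 : (L.map Prod.snd).Nodup)
    (hed : ∀ p ∈ ed, ∃ a b, (p.1, a) ∈ L ∧ (p.2, b) ∈ L ∧ G.Adj a b)
    (hch : ∀ v ∈ S, dg G S v = hi → dg G (cl G S q) v ≤ kh) (hcl : ∀ v ∈ S, dg G S v = lo → dg G (cl G S q) v ≤ kl)
    (hex : kh ≤ K.getD 0 0 ∨ ∃ y, (0, y) ∈ L ∧ dg G (cl G S q) y ≤ K.getD 0 0) : False := by
  unfold chk3 at hchk3
  simp only [Bool.and_eq_true, List.all_eq_true, decide_eq_true_eq, List.mem_range, Bool.or_eq_true] at hchk3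
  obtain ⟨h3, h4⟩ := hchk3
  refine finish hrun hchk hchk2 hn h S ?_ ?_ L hL h1 h2 hed ?_
  · intro x hx; rcases hS x hx with e | e <;> omega
  · intro k hk
    have h5 := h3 k hk
    have h6 : ((Finset.range n).filter (fun i => D.getD i 0 = k)).card = ((List.range n).filter (fun i => decide (D.getD i 0 = k))).length := by
      rw [← List.toFinset_card_of_nodup (List.nodup_range.filter _)]
      congr 1
      ext i; simp
    rw [h6, h5]
    split_ifs with e1 e2
    · rw [e1]; exact ha
    · rw [e2]; exact hb
    · rw [Finset.filter_false_of_mem]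
      · rfl
      · intro x hx hxk; rcases hS x hx with e | e <;> omega
  · intro i hi' v hv hd hlab
    show dg G (cl G S q) v ≤ _
    obtain ⟨⟨h5, h6⟩, h7⟩ := h4 i hi'
    rcases h7 with h7 | h7
    · have h8 := hch v hv (by omega)
      rcases h5 with (h5 | h5) | h5
      · subst h5
        rcases hex with hex | ⟨y, hy, hex⟩
        · omega
        · rw [hlab _ hy rfl]; exact hex
      · exact (h5 h7).elim
      · omega
    · have h8 := hcl v hv (by omega)
      rcases h6 with h6 | h6
      · exact (h6 h7).elim
      · omega
theorem dg_le_dg (S : Finset V) (k : ℕ) (x : V) : dg G (cl G S k) x ≤ dg G S x := dg_mono G (Finset.filter_subset _ _) x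
end
end TS

namespace TS
section
variable {V : Type} [DecidableEq V] {G : SimpleGraph V} [DecidableRel G.Adj]
theorem t_14 : run (mkCfg 14 0 [0] [4, 4, 4, 4, 4, 4, 3, 3, 3, 3, 3, 3, 3, 3] [] [9, 9, 9, 9, 9, 9, 9, 9, 9, 9, 9, 9, 9, 9]) 14 1461501637671185285203851458712368708759249223681 [] = true := by decide +kernel
theorem case_14 (h : G5 G) (S : Finset V) (hS : ∀ x ∈ S, dg G S x = 4 ∨ dg G S x = 3)
    (ha : (cl G S 4).card = 6) (hb : (cl G S 3).card = 8) : False := by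
  have hq : cl G S 99 = ∅ := by
    apply Finset.filter_false_of_mem
    intro x hx hh; have := hS x hx; omega
  refine finish2 (q := 99) (hi := 4) (lo := 3) (a := 6) (b := 8) (kh := 0) (kl := 0) t_14 (by decide +kernel) (by decide +kernel) (by decide +kernel) (by norm_num) (by norm_num) (by norm_num) h S hS ha hb [] ?_ (by simp) ?_ ?_ (fun v hv hd => by simp [hq, dg]) (fun v hv hd => by simp [hq, dg]) (Or.inl (by decide +kernel))
  · simp
  · simp
  · simp
theorem t_16a : run (mkCfg 16 0 [] [5, 4, 4, 4, 4, 4, 4, 4, 4, 3, 3, 3, 3, 3, 3, 3] [1, 2, 3, 4, 5, 6, 7, 8] [0, 3, 3, 3, 3, 3, 3, 3, 3, 9, 9, 9, 9, 9, 9, 9]) 16 115792089264276142096998726540203105341796590047689226336812880642240023625730 [] = true := by decide +kernel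
theorem case_16a (h : G5 G) (S : Finset V) (hS : ∀ x ∈ S, dg G S x = 5 ∨ dg G S x = 4 ∨ dg G S x = 3)
    (h5 : (cl G S 5).card = 1) (h4 : (cl G S 4).card = 8) (h3 : (cl G S 3).card = 7)
    (hc5 : ∀ v ∈ S, dg G S v = 5 → dg G (cl G S 4) v = 0) (hc4 : ∀ v ∈ S, dg G S v = 4 → dg G (cl G S 4) v ≤ 3) : False := by
  refine finish (q := 4) t_16a (by decide +kernel) (by decide +kernel) (by norm_num) h S ?_ ?_ [] (by simp) (by simp) (by simp) (by simp) ?_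
  · intro x hx; have := hS x hx; omega
  · intro k hk
    have hz : ∀ k, k ≠ 5 → k ≠ 4 → k ≠ 3 → (S.filter (fun x => dg G S x = k)).card = 0 := by
      intro k h1 h2 h3
      rw [Finset.filter_false_of_mem]
      · rfl
      · intro x hx hxk; have := hS x hx; omega
    interval_cases k
    · rw [hz _ (by norm_num) (by norm_num) (by norm_num)]; decide +kernel
    · rw [hz _ (by norm_num) (by norm_num) (by norm_num)]; decide +kernel
    · rw [hz _ (by norm_num) (by norm_num) (by norm_num)]; decide +kernel
    · refine Eq.trans h3 ?_; decide +kernel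
    · refine Eq.trans h4 ?_; decide +kernel
    · refine Eq.trans h5 ?_; decide +kernel
    · rw [hz _ (by norm_num) (by norm_num) (by norm_num)]; decide +kernel
    · rw [hz _ (by norm_num) (by norm_num) (by norm_num)]; decide +kernel
  · intro i hi v hv hd _
    show dg G (cl G S 4) v ≤ _
    have h1 := hc5 v hv
    have h2 := hc4 v hv
    have h6 := dg_le_dg (G := G) S 4 v
    interval_cases i <;> simp at hd ⊢ <;> omega

theorem t_16b : run (mkCfg 16 0 [0] [4, 4, 4, 4, 4, 4, 4, 4, 4, 4, 3, 3, 3, 3, 3, 3] [0, 1, 2, 3, 4, 5, 6, 7, 8, 9] [3, 3, 3, 3, 3, 3, 3, 3, 3, 3, 9, 9, 9, 9, 9, 9]) 16 497323236525578731419658390243819566640659256139144307488153203229972377654773399158785 [(0, 1), (0, 2), (0, 3)] = true := by decide +kernel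
theorem case_16b (h : G5 G) (S : Finset V) (hS : ∀ x ∈ S, dg G S x = 4 ∨ dg G S x = 3)
    (ha : (cl G S 4).card = 10) (hb : (cl G S 3).card = 6)
    (hc : ∀ v ∈ S, dg G S v = 4 → dg G (cl G S 4) v ≤ 3)
    (x0 x1 x2 x3 : V) (m0 : x0 ∈ cl G S 4) (m1 : x1 ∈ cl G S 4) (m2 : x2 ∈ cl G S 4) (m3 : x3 ∈ cl G S 4)
    (hnd : [x0, x1, x2, x3].Nodup) (e0 : G.Adj x0 x1) (e1 : G.Adj x0 x2) (e2 : G.Adj x0 x3) : False := by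
  have l0 := mem_cl.1 m0
  have l1 := mem_cl.1 m1
  have l2 := mem_cl.1 m2
  have l3 := mem_cl.1 m3
  refine finish2 (q := 4) (hi := 4) (lo := 3) (a := 10) (b := 6) (kh := 3) (kl := 3) t_16b (by decide +kernel) (by decide +kernel) (by decide +kernel) (by norm_num) (by norm_num) (by norm_num) h S hS ha hb [(0, x0), (1, x1), (2, x2), (3, x3)] ?_ (by simp) ?_ ?_ (fun v hv hd => hc v hv hd) (fun v hv hd => hd ▸ dg_le_dg S 4 v) (Or.inl (by decide +kernel))
  · simp [l0.1, l0.2, l1.1, l1.2, l2.1, l2.2, l3.1, l3.2]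
  · exact hnd
  · simp [e0, e1, e2]
theorem t_21 : run (mkCfg 21 0 [0] [5, 5, 5, 5, 5, 5, 4, 4, 4, 4, 4, 4, 4, 4, 4, 4, 4, 4, 4, 4, 4] [0, 1, 2, 3, 4, 5] [0, 0, 0, 0, 0, 0, 9, 9, 9, 9, 9, 9, 9, 9, 9, 9, 9, 9, 9, 9, 9]) 21 1461501637671185285203851458712368708759249223681 [] = true := by decide +kernel
theorem case_21 (h : G5 G) (S : Finset V) (hS : ∀ x ∈ S, dg G S x = 5 ∨ dg G S x = 4)
    (ha : (cl G S 5).card = 6) (hb : (cl G S 4).card = 15)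
    (hc : ∀ v ∈ S, dg G S v = 5 → dg G (cl G S 5) v ≤ 0) : False := by
  refine finish2 (q := 5) (hi := 5) (lo := 4) (a := 6) (b := 15) (kh := 0) (kl := 4) t_21 (by decide +kernel) (by decide +kernel) (by decide +kernel) (by norm_num) (by norm_num) (by norm_num) h S hS ha hb [] ?_ (by simp) ?_ ?_ (fun v hv hd => hc v hv hd) (fun v hv hd => hd ▸ dg_le_dg S 5 v) (Or.inl (by decide +kernel))
  · simp
  · simp
  · simp
theorem t_22 : run (mkCfg 22 0 [0] [5, 5, 5, 5, 5, 5, 5, 5, 4, 4, 4, 4, 4, 4, 4, 4, 4, 4, 4, 4, 4, 4] [0, 1, 2, 3, 4, 5, 6, 7] [1, 1, 1, 1, 1, 1, 1, 1, 9, 9, 9, 9, 9, 9, 9, 9, 9, 9, 9, 9, 9, 9]) 22 26959946673427741531515197488526605382048662297355296634326893985793 [(0, 1), (2, 3), (4, 5), (6, 7)] = true := by decide +kernel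
theorem case_22 (h : G5 G) (S : Finset V) (hS : ∀ x ∈ S, dg G S x = 5 ∨ dg G S x = 4)
    (ha : (cl G S 5).card = 8) (hb : (cl G S 4).card = 14)
    (hc : ∀ v ∈ S, dg G S v = 5 → dg G (cl G S 5) v ≤ 1)
    (x0 x1 x2 x3 x4 x5 x6 x7 : V) (m0 : x0 ∈ cl G S 5) (m1 : x1 ∈ cl G S 5) (m2 : x2 ∈ cl G S 5) (m3 : x3 ∈ cl G S 5) (m4 : x4 ∈ cl G S 5) (m5 : x5 ∈ cl G S 5) (m6 : x6 ∈ cl G S 5) (m7 : x7 ∈ cl G S 5)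
    (hnd : [x0, x1, x2, x3, x4, x5, x6, x7].Nodup) (e0 : G.Adj x0 x1) (e1 : G.Adj x2 x3) (e2 : G.Adj x4 x5) (e3 : G.Adj x6 x7) : False := by
  have l0 := mem_cl.1 m0
  have l1 := mem_cl.1 m1
  have l2 := mem_cl.1 m2
  have l3 := mem_cl.1 m3
  have l4 := mem_cl.1 m4
  have l5 := mem_cl.1 m5
  have l6 := mem_cl.1 m6
  have l7 := mem_cl.1 m7
  refine finish2 (q := 5) (hi := 5) (lo := 4) (a := 8) (b := 14) (kh := 1) (kl := 4) t_22 (by decide +kernel) (by decide +kernel) (by decide +kernel) (by norm_num) (by norm_num) (by norm_num) h S hS ha hb [(0, x0), (1, x1), (2, x2), (3, x3), (4, x4), (5, x5), (6, x6), (7, x7)] ?_ (by simp) ?_ ?_ (fun v hv hd => hc v hv hd) (fun v hv hd => hd ▸ dg_le_dg S 5 v) (Or.inl (by decide +kernel))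
  · simp [l0.1, l0.2, l1.1, l1.2, l2.1, l2.2, l3.1, l3.2, l4.1, l4.2, l5.1, l5.2, l6.1, l6.2, l7.1, l7.2]
  · exact hnd
  · simp [e0, e1, e2, e3]
theorem t_23 : run (mkCfg 23 0 [0] [5, 5, 5, 5, 5, 5, 5, 5, 5, 5, 4, 4, 4, 4, 4, 4, 4, 4, 4, 4, 4, 4, 4] [0, 1, 2, 3, 4, 5, 6, 7, 8, 9] [2, 2, 2, 2, 2, 2, 2, 2, 2, 2, 9, 9, 9, 9, 9, 9, 9, 9, 9, 9, 9, 9, 9]) 23 497323236525578731419658390243819566640659256139144307488153203229972377654773399158785 [(0, 1), (0, 2)] = true := by decide +kernel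
theorem case_23 (h : G5 G) (S : Finset V) (hS : ∀ x ∈ S, dg G S x = 5 ∨ dg G S x = 4)
    (ha : (cl G S 5).card = 10) (hb : (cl G S 4).card = 13)
    (hc : ∀ v ∈ S, dg G S v = 5 → dg G (cl G S 5) v ≤ 2)
    (x0 x1 x2 : V) (m0 : x0 ∈ cl G S 5) (m1 : x1 ∈ cl G S 5) (m2 : x2 ∈ cl G S 5)
    (hnd : [x0, x1, x2].Nodup) (e0 : G.Adj x0 x1) (e1 : G.Adj x0 x2) : False := by
  have l0 := mem_cl.1 m0
  have l1 := mem_cl.1 m1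
  have l2 := mem_cl.1 m2
  refine finish2 (q := 5) (hi := 5) (lo := 4) (a := 10) (b := 13) (kh := 2) (kl := 4) t_23 (by decide +kernel) (by decide +kernel) (by decide +kernel) (by norm_num) (by norm_num) (by norm_num) h S hS ha hb [(0, x0), (1, x1), (2, x2)] ?_ (by simp) ?_ ?_ (fun v hv hd => hc v hv hd) (fun v hv hd => hd ▸ dg_le_dg S 5 v) (Or.inl (by decide +kernel))
  · simp [l0.1, l0.2, l1.1, l1.2, l2.1, l2.2]
  · exact hnd
  · simp [e0, e1]
theorem t_M2 : run (mkCfg 24 3 [1, 4, 2, 5] [5, 5, 5, 5, 5, 5, 5, 5, 5, 5, 5, 5, 4, 4, 4, 4, 4, 4, 4, 4, 4, 4, 4, 4] [0, 1, 2, 3, 4, 5, 6, 7, 8, 9, 10, 11] [2, 2, 2, 2, 2, 2, 2, 2, 2, 2, 2, 2, 9, 9, 9, 9, 9, 9, 9, 9, 9, 9, 9, 9]) 24 9173994466096273082861516900128948200775470461519648583947667383633877419664312161290687140118238232313857 [(1, 2), (2, 3), (3, 4), (4, 5)] = true := by decide +kernel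
theorem case_M2 (h : G5 G) (S : Finset V) (hS : ∀ x ∈ S, dg G S x = 5 ∨ dg G S x = 4)
    (ha : (cl G S 5).card = 12) (hb : (cl G S 4).card = 12)
    (hc : ∀ v ∈ S, dg G S v = 5 → dg G (cl G S 5) v ≤ 2)
    (x1 x2 x3 x4 x5 : V) (m1 : x1 ∈ cl G S 5) (m2 : x2 ∈ cl G S 5) (m3 : x3 ∈ cl G S 5) (m4 : x4 ∈ cl G S 5) (m5 : x5 ∈ cl G S 5)
    (hnd : [x1, x2, x3, x4, x5].Nodup) (e0 : G.Adj x1 x2) (e1 : G.Adj x2 x3) (e2 : G.Adj x3 x4) (e3 : G.Adj x4 x5) : False := by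
  have l1 := mem_cl.1 m1
  have l2 := mem_cl.1 m2
  have l3 := mem_cl.1 m3
  have l4 := mem_cl.1 m4
  have l5 := mem_cl.1 m5
  refine finish2 (q := 5) (hi := 5) (lo := 4) (a := 12) (b := 12) (kh := 2) (kl := 4) t_M2 (by decide +kernel) (by decide +kernel) (by decide +kernel) (by norm_num) (by norm_num) (by norm_num) h S hS ha hb [(1, x1), (2, x2), (3, x3), (4, x4), (5, x5)] ?_ (by simp) ?_ ?_ (fun v hv hd => hc v hv hd) (fun v hv hd => hd ▸ dg_le_dg S 5 v) (Or.inl (by decide +kernel))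
  · simp [l1.1, l1.2, l2.1, l2.2, l3.1, l3.2, l4.1, l4.2, l5.1, l5.2]
  · exact hnd
  · simp [e0, e1, e2, e3]
theorem t_A : run (mkCfg 24 1 [1, 2, 3, 12, 13, 0] [5, 5, 5, 5, 5, 5, 5, 5, 5, 5, 5, 5, 4, 4, 4, 4, 4, 4, 4, 4, 4, 4, 4, 4] [0, 1, 2, 3, 4, 5, 6, 7, 8, 9, 10, 11] [1, 3, 3, 3, 3, 3, 3, 3, 3, 3, 3, 3, 9, 9, 9, 9, 9, 9, 9, 9, 9, 9, 9, 9]) 24 18347988932192546165723033800257896401550940923039297167895334767267754839328624322581374280236476464627713 [(0, 1), (1, 2), (1, 3), (1, 12), (1, 13)] = true := by decide +kernel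
theorem case_A (h : G5 G) (S : Finset V) (hS : ∀ x ∈ S, dg G S x = 5 ∨ dg G S x = 4)
    (ha : (cl G S 5).card = 12) (hb : (cl G S 4).card = 12)
    (hc : ∀ v ∈ S, dg G S v = 5 → dg G (cl G S 5) v ≤ 3)
    (x0 x1 x2 x3 x12 x13 : V) (m0 : x0 ∈ cl G S 5) (m1 : x1 ∈ cl G S 5) (m2 : x2 ∈ cl G S 5) (m3 : x3 ∈ cl G S 5) (m12 : x12 ∈ cl G S 4) (m13 : x13 ∈ cl G S 4)
    (hnd : [x0, x1, x2, x3, x12, x13].Nodup) (e0 : G.Adj x0 x1) (e1 : G.Adj x1 x2) (e2 : G.Adj x1 x3) (e3 : G.Adj x1 x12) (e4 : G.Adj x1 x13)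
    (hy : dg G (cl G S 5) x0 ≤ 1) : False := by
  have l0 := mem_cl.1 m0
  have l1 := mem_cl.1 m1
  have l2 := mem_cl.1 m2
  have l3 := mem_cl.1 m3
  have l12 := mem_cl.1 m12
  have l13 := mem_cl.1 m13
  refine finish2 (q := 5) (hi := 5) (lo := 4) (a := 12) (b := 12) (kh := 3) (kl := 4) t_A (by decide +kernel) (by decide +kernel) (by decide +kernel) (by norm_num) (by norm_num) (by norm_num) h S hS ha hb [(0, x0), (1, x1), (2, x2), (3, x3), (12, x12), (13, x13)] ?_ (by simp) ?_ ?_ (fun v hv hd => hc v hv hd) (fun v hv hd => hd ▸ dg_le_dg S 5 v) (Or.inr ⟨x0, by simp, by simpa using hy⟩)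
  · simp [l0.1, l0.2, l1.1, l1.2, l2.1, l2.2, l3.1, l3.2, l12.1, l12.2, l13.1, l13.2]
  · exact hnd
  · simp [e0, e1, e2, e3, e4]
theorem t_Bf : run (mkCfg 24 1 [0, 2, 3, 4, 12, 13] [5, 5, 5, 5, 5, 5, 5, 5, 5, 5, 5, 5, 4, 4, 4, 4, 4, 4, 4, 4, 4, 4, 4, 4] [0, 1, 2, 3, 4, 5, 6, 7, 8, 9, 10, 11] [1, 3, 3, 3, 3, 3, 3, 3, 3, 3, 3, 3, 9, 9, 9, 9, 9, 9, 9, 9, 9, 9, 9, 9]) 24 18347988932192546165723033800257896401550940923039297167895334767267754839328624322581374280236476464627713 [(1, 2), (1, 3), (1, 4), (1, 12), (1, 13), (0, 2)] = true := by decide +kernel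
theorem case_Bf (h : G5 G) (S : Finset V) (hS : ∀ x ∈ S, dg G S x = 5 ∨ dg G S x = 4)
    (ha : (cl G S 5).card = 12) (hb : (cl G S 4).card = 12)
    (hc : ∀ v ∈ S, dg G S v = 5 → dg G (cl G S 5) v ≤ 3)
    (x0 x1 x2 x3 x4 x12 x13 : V) (m0 : x0 ∈ cl G S 5) (m1 : x1 ∈ cl G S 5) (m2 : x2 ∈ cl G S 5) (m3 : x3 ∈ cl G S 5) (m4 : x4 ∈ cl G S 5) (m12 : x12 ∈ cl G S 4) (m13 : x13 ∈ cl G S 4)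
    (hnd : [x0, x1, x2, x3, x4, x12, x13].Nodup) (e0 : G.Adj x1 x2) (e1 : G.Adj x1 x3) (e2 : G.Adj x1 x4) (e3 : G.Adj x1 x12) (e4 : G.Adj x1 x13) (e5 : G.Adj x0 x2)
    (hy : dg G (cl G S 5) x0 ≤ 1) : False := by
  have l0 := mem_cl.1 m0
  have l1 := mem_cl.1 m1
  have l2 := mem_cl.1 m2
  have l3 := mem_cl.1 m3
  have l4 := mem_cl.1 m4
  have l12 := mem_cl.1 m12
  have l13 := mem_cl.1 m13
  refine finish2 (q := 5) (hi := 5) (lo := 4) (a := 12) (b := 12) (kh := 3) (kl := 4) t_Bf (by decide +kernel) (by decide +kernel) (by decide +kernel) (by norm_num) (by norm_num) (by norm_num) h S hS ha hb [(0, x0), (1, x1), (2, x2), (3, x3), (4, x4), (12, x12), (13, x13)] ?_ (by simp) ?_ ?_ (fun v hv hd => hc v hv hd) (fun v hv hd => hd ▸ dg_le_dg S 5 v) (Or.inr ⟨x0, by simp, by simpa using hy⟩)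
  · simp [l0.1, l0.2, l1.1, l1.2, l2.1, l2.2, l3.1, l3.2, l4.1, l4.2, l12.1, l12.2, l13.1, l13.2]
  · exact hnd
  · simp [e0, e1, e2, e3, e4, e5]
theorem t_Bg : run (mkCfg 24 1 [2] [5, 5, 5, 5, 5, 5, 5, 5, 5, 5, 5, 5, 4, 4, 4, 4, 4, 4, 4, 4, 4, 4, 4, 4] [0, 1, 2, 3, 4, 5, 6, 7, 8, 9, 10, 11] [1, 3, 3, 3, 3, 3, 3, 3, 3, 3, 3, 3, 9, 9, 9, 9, 9, 9, 9, 9, 9, 9, 9, 9]) 24 18347988932192546165723033800257896401550940923039297167895334767267754839328624322581374280236476464627713 [(1, 2), (1, 3), (1, 4), (1, 12), (1, 13), (0, 12)] = true := by decide +kernel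
theorem case_Bg (h : G5 G) (S : Finset V) (hS : ∀ x ∈ S, dg G S x = 5 ∨ dg G S x = 4)
    (ha : (cl G S 5).card = 12) (hb : (cl G S 4).card = 12)
    (hc : ∀ v ∈ S, dg G S v = 5 → dg G (cl G S 5) v ≤ 3)
    (x0 x1 x2 x3 x4 x12 x13 : V) (m0 : x0 ∈ cl G S 5) (m1 : x1 ∈ cl G S 5) (m2 : x2 ∈ cl G S 5) (m3 : x3 ∈ cl G S 5) (m4 : x4 ∈ cl G S 5) (m12 : x12 ∈ cl G S 4) (m13 : x13 ∈ cl G S 4)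
    (hnd : [x0, x1, x2, x3, x4, x12, x13].Nodup) (e0 : G.Adj x1 x2) (e1 : G.Adj x1 x3) (e2 : G.Adj x1 x4) (e3 : G.Adj x1 x12) (e4 : G.Adj x1 x13) (e5 : G.Adj x0 x12)
    (hy : dg G (cl G S 5) x0 ≤ 1) : False := by
  have l0 := mem_cl.1 m0
  have l1 := mem_cl.1 m1
  have l2 := mem_cl.1 m2
  have l3 := mem_cl.1 m3
  have l4 := mem_cl.1 m4
  have l12 := mem_cl.1 m12
  have l13 := mem_cl.1 m13
  refine finish2 (q := 5) (hi := 5) (lo := 4) (a := 12) (b := 12) (kh := 3) (kl := 4) t_Bg (by decide +kernel) (by decide +kernel) (by decide +kernel) (by norm_num) (by norm_num) (by norm_num) h S hS ha hb [(0, x0), (1, x1), (2, x2), (3, x3), (4, x4), (12, x12), (13, x13)] ?_ (by simp) ?_ ?_ (fun v hv hd => hc v hv hd) (fun v hv hd => hd ▸ dg_le_dg S 5 v) (Or.inr ⟨x0, by simp, by simpa using hy⟩)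
  · simp [l0.1, l0.2, l1.1, l1.2, l2.1, l2.2, l3.1, l3.2, l4.1, l4.2, l12.1, l12.2, l13.1, l13.2]
  · exact hnd
  · simp [e0, e1, e2, e3, e4, e5]
end
end TS

namespace TS
section
variable {V : Type} [DecidableEq V] {G : SimpleGraph V} [DecidableRel G.Adj]

def Bd (G : SimpleGraph V) [DecidableRel G.Adj] (n m : ℕ) : Prop :=
  ∀ S : Finset V, S.card = n → 2 * m ≤ es G S → False

theorem mindeg {n m : ℕ} (hB : Bd G n m) (S : Finset V) (hc : S.card = n + 1) (d : ℕ)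
    (hd : 2 * m + 2 * d ≤ es G S) : ∀ v ∈ S, d + 1 ≤ dg G S v := by
  intro v hv
  by_contra hlt
  have := es_erase G S v hv
  refine hB (S.erase v) ?_ (by omega)
  rw [Finset.card_erase_of_mem hv]; omega

theorem ex_big (S : Finset V) (f : V → ℕ) (k : ℕ) (h : k * S.card < ∑ x ∈ S, f x) : ∃ x ∈ S, k + 1 ≤ f x := by
  by_contra hh
  push Not at hh
  have : ∑ x ∈ S, f x ≤ ∑ x ∈ S, k := Finset.sum_le_sum (fun x hx => by have := hh x hx; omega)
  rw [Finset.sum_const, smul_eq_mul, mul_comm] at this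
  omega

theorem stepA (h : G5 G) {n m : ℕ} (hB : Bd G n m) (M d k : ℕ) (h1 : m + d ≤ M) (h2 : k * (n + 1) < 2 * M)
    (h3 : n + 1 < (d + 1) * (k + 1) + 1) : Bd G (n + 1) M := by
  intro S hc he
  have hm := mindeg hB S hc d (by omega)
  obtain ⟨x, hx, hk⟩ := ex_big S (dg G S) k (by rw [hc]; exact lt_of_lt_of_le h2 he)
  have := ball h S x hx (d + 1) hm
  have h4 : (d + 1) * (k + 1) ≤ (d + 1) * dg G S x := Nat.mul_le_mul_left _ hk
  omega

theorem sum_sq (T : Finset V) (f : V → ℕ) (a b : ℕ) (hb : ∀ x ∈ T, a * f x ≤ f x * f x + b) :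
    a * ∑ x ∈ T, f x ≤ ∑ x ∈ T, f x * f x + b * T.card := by
  have := Finset.sum_le_sum hb
  rw [← Finset.mul_sum, Finset.sum_add_distrib, Finset.sum_const, smul_eq_mul, mul_comm T.card] at this
  exact this

theorem split2 (S : Finset V) {hi lo : ℕ} (hne : hi ≠ lo) (hS : ∀ x ∈ S, dg G S x = hi ∨ dg G S x = lo) (f : V → ℕ) :
    ∑ x ∈ S, f x = ∑ x ∈ cl G S hi, f x + ∑ x ∈ cl G S lo, f x := by
  rw [← Finset.sum_filter_add_sum_filter_not S (fun x => dg G S x = hi)]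
  congr 1
  apply Finset.sum_congr _ (fun _ _ => rfl)
  unfold cl
  apply Finset.filter_congr
  intro x hx; have := hS x hx; omega

theorem sum_cl (S : Finset V) (k : ℕ) : ∑ x ∈ cl G S k, dg G S x = k * (cl G S k).card := by
  rw [Finset.sum_congr rfl (fun x hx => (mem_cl.1 hx).2), Finset.sum_const, smul_eq_mul, mul_comm]

theorem count2 (S : Finset V) {hi lo : ℕ} (hne : hi ≠ lo) (hS : ∀ x ∈ S, dg G S x = hi ∨ dg G S x = lo) :
    S.card = (cl G S hi).card + (cl G S lo).card ∧ es G S = hi * (cl G S hi).card + lo * (cl G S lo).card := by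
  constructor
  · have := split2 S hne hS (fun _ => 1)
    simpa using this
  · rw [← sum_cl, ← sum_cl]
    exact split2 S hne hS _

theorem dg2 (S : Finset V) {hi lo : ℕ} (hne : hi ≠ lo) (hS : ∀ x ∈ S, dg G S x = hi ∨ dg G S x = lo) (x : V) :
    dg G S x = dg G (cl G S hi) x + dg G (cl G S lo) x := by
  simp only [dg_sum]
  exact split2 S hne hS _

theorem ball2 (h : G5 G) (S : Finset V) (p : ℕ) (hS : ∀ x ∈ S, dg G S x = p + 1 ∨ dg G S x = p) (x : V) (hx : x ∈ S) :
    p * dg G S x + dg G (cl G S (p + 1)) x + (far G S x).card + 1 = S.card := by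
  rw [← ball_eq h S x hx]
  congr 2
  have h1 : ∀ y ∈ S.filter (fun y => G.Adj x y), dg G S y = p + if dg G S y = p + 1 then 1 else 0 := by
    intro y hy
    have := hS y (Finset.mem_filter.1 hy).1
    split_ifs <;> omega
  rw [Finset.sum_congr rfl h1, Finset.sum_add_distrib, Finset.sum_const, smul_eq_mul, ← Finset.card_filter, mul_comm]
  congr 1
  unfold dg cl
  rw [Finset.filter_filter, Finset.filter_filter]
  congr 1
  apply Finset.filter_congr
  intro y hy; exact and_comm

theorem pair2 (h : G5 G) (S : Finset V) {hi lo : ℕ} (hne : hi ≠ lo) (hS : ∀ x ∈ S, dg G S x = hi ∨ dg G S x = lo) :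
    ∑ x ∈ cl G S hi, dg G (cl G S hi) x * dg G (cl G S hi) x + ∑ x ∈ cl G S lo, dg G (cl G S hi) x * dg G (cl G S hi) x
      + es G (cl G S hi) ≤ (cl G S hi).card * ((cl G S hi).card - 1) + hi * (cl G S hi).card ∧
    es G (cl G S hi) + ∑ x ∈ cl G S lo, dg G (cl G S hi) x = hi * (cl G S hi).card := by
  have h1 := pair_lemma h S (cl G S hi)
  have h2 := dg_dc G S (cl G S hi)
  rw [sum_cl] at h2
  have h3 := split2 S hne hS (dg G (cl G S hi))
  have h4 := split2 S hne hS (fun x => dg G (cl G S hi) x * dg G (cl G S hi) x)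
  have h5 : es G (cl G S hi) = ∑ x ∈ cl G S hi, dg G (cl G S hi) x := rfl
  rw [← h5] at h1
  rw [← h5] at h3
  constructor
  · rw [h4, h2] at h1; exact h1
  · omega

theorem nb1 {T : Finset V} {x : V} (h : 1 ≤ dg G T x) : ∃ a ∈ T, G.Adj x a := by
  obtain ⟨a, ha⟩ := Finset.card_pos.1 h
  exact ⟨a, Finset.mem_filter.1 ha⟩

theorem nb2 {T : Finset V} {x : V} (h : 2 ≤ dg G T x) : ∃ a ∈ T, ∃ b ∈ T, a ≠ b ∧ G.Adj x a ∧ G.Adj x b := by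
  obtain ⟨a, ha, b, hb, hab⟩ := Finset.one_lt_card.1 h
  rw [Finset.mem_filter] at ha hb
  exact ⟨a, ha.1, b, hb.1, hab, ha.2, hb.2⟩

theorem nb3 {T : Finset V} {x : V} (h : 3 ≤ dg G T x) :
    ∃ a ∈ T, ∃ b ∈ T, ∃ c ∈ T, a ≠ b ∧ a ≠ c ∧ b ≠ c ∧ G.Adj x a ∧ G.Adj x b ∧ G.Adj x c := by
  obtain ⟨a, b, c, ha, hb, hc, hab, hac, hbc⟩ := Finset.two_lt_card_iff.1 h
  rw [Finset.mem_filter] at ha hb hc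
  exact ⟨a, ha.1, b, hb.1, c, hc.1, hab, hac, hbc, ha.2, hb.2, hc.2⟩

theorem B10 (h : G5 G) : Bd G 10 16 := by
  intro S hc he
  have h1 := pair_lemma h S S
  have h2 := sum_sq S (dg G S) 6 9 (fun x _ => by nlinarith [sq_nonneg ((dg G S x : ℤ) - 3), sq_nonneg (dg G S x)])
  rw [hc] at h1 h2
  have h3 : es G S = ∑ x ∈ S, dg G S x := rfl
  omega
end
end TS

namespace TS
section
variable {V : Type} [DecidableEq V] {G : SimpleGraph V} [DecidableRel G.Adj]

theorem q_aux (c k : ℕ) : (2 * k + 1) * c ≤ c * c + k * (k + 1) := by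
  rcases Nat.lt_or_ge c (k + 1) with h | h
  · obtain ⟨d, rfl⟩ := Nat.exists_eq_add_of_le (Nat.lt_succ_iff.1 h)
    nlinarith [Nat.zero_le d, Nat.zero_le c]
  · obtain ⟨d, rfl⟩ := Nat.exists_eq_add_of_le h
    nlinarith [Nat.zero_le d, Nat.zero_le k]

theorem B11 (h : G5 G) : Bd G 11 17 := by
  have h18 : Bd G 11 18 := stepA h (B10 h) 18 2 3 (by norm_num) (by norm_num) (by norm_num)
  intro S hc he
  have hm := mindeg (B10 h) S hc 1 (by omega)
  have he' : es G S = 34 := by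
    obtain ⟨k, hk⟩ := es_even G S
    have := h18 S hc
    by_contra hne
    exact this (by omega)
  have hv : ∃ v ∈ S, dg G S v = 2 := by
    by_contra hno
    push Not at hno
    obtain ⟨x, hx, hk⟩ := ex_big S (dg G S) 3 (by rw [hc]; exact lt_of_lt_of_le (by norm_num) he)
    have := ball h S x hx 3 (fun y hy => by have := hm y hy; have := hno y hy; omega)
    omega
  obtain ⟨v, hvS, hv⟩ := hv
  have e1 := es_erase G S v hvS
  have c1 : (S.erase v).card = 10 := by rw [Finset.card_erase_of_mem hvS]; omega
  set T := S.erase v with hT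
  have h1 := pair_lemma h T T
  have h3 : es G T = ∑ x ∈ T, dg G T x := rfl
  rw [c1] at h1
  have hall : ∀ x ∈ T, dg G T x = 3 := by
    intro x hx
    by_contra hne
    have h2 := sum_sq (T.erase x) (dg G T) 6 9 (fun x _ => by nlinarith [sq_nonneg ((dg G T x : ℤ) - 3), sq_nonneg (dg G T x)])
    rw [Finset.card_erase_of_mem hx, c1] at h2
    have h4 := Finset.sum_erase_add T (dg G T) hx
    have h5 := Finset.sum_erase_add T (fun x => dg G T x * dg G T x) hx
    have h6 : 6 * dg G T x + 1 ≤ dg G T x * dg G T x + 9 := by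
      rcases Nat.lt_or_ge (dg G T x) 3 with h | h
      · interval_cases (dg G T x) <;> omega
      · obtain ⟨d, hd⟩ := Nat.exists_eq_add_of_le (show 4 ≤ dg G T x by omega)
        rw [hd]; nlinarith
    omega
  obtain ⟨a, ha, b, hb, hab, va, vb⟩ := nb2 (le_of_eq hv.symm)
  have haT : a ∈ T := Finset.mem_erase.2 ⟨fun e => by subst e; exact G.loopless.irrefl _ va, ha⟩
  have hbT : b ∈ T := Finset.mem_erase.2 ⟨fun e => by subst e; exact G.loopless.irrefl _ vb, hb⟩
  have hbal := ball_eq h T a haT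
  rw [Finset.sum_congr rfl (fun x hx => hall x (Finset.mem_filter.1 hx).1), Finset.sum_const, smul_eq_mul] at hbal
  have : (T.filter (fun y => G.Adj a y)).card = 3 := hall a haT
  rw [this, c1] at hbal
  have hf : far G T a = ∅ := Finset.card_eq_zero.1 (by omega)
  have hbf : b ∉ far G T a := by rw [hf]; simp
  apply hbf
  unfold far
  rw [Finset.mem_filter]
  refine ⟨hbT, hab.symm, fun e => h.tri v a b va e vb, fun y hy e1 e2 => ?_⟩
  rcases h.quad v a y b va e1 e2 vb.symm with e | e
  · exact (Finset.mem_erase.1 hy).1 e.symm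
  · exact hab e

theorem B12 (h : G5 G) : Bd G 12 19 := stepA h (B11 h) 19 2 3 (by norm_num) (by norm_num) (by norm_num)
theorem B13 (h : G5 G) : Bd G 13 22 := stepA h (B12 h) 22 3 3 (by norm_num) (by norm_num) (by norm_num)

theorem ev {n m : ℕ} (hB : Bd G n (m + 1)) (S : Finset V) (hc : S.card = n) (he : 2 * m ≤ es G S) : es G S = 2 * m := by
  obtain ⟨k, hk⟩ := es_even G S
  by_contra hne
  exact hB S hc (by omega)

theorem B14 (h : G5 G) : Bd G 14 24 := by
  have h25 : Bd G 14 25 := stepA h (B13 h) 25 3 3 (by norm_num) (by norm_num) (by norm_num)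
  intro S hc he
  have he' := ev h25 S hc he
  have hm := mindeg (B13 h) S hc 2 (by omega)
  have hS : ∀ x ∈ S, dg G S x = 4 ∨ dg G S x = 3 := by
    intro x hx
    have := ball h S x hx 3 hm
    have := hm x hx
    omega
  have h2 := count2 S (by norm_num) hS
  exact case_14 h S hS (by omega) (by omega)

theorem B15 (h : G5 G) : Bd G 15 27 := stepA h (B14 h) 27 3 3 (by norm_num) (by norm_num) (by norm_num)

theorem dg_dis (T U : Finset V) (hd : Disjoint T U) (x : V) : dg G (T ∪ U) x = dg G T x + dg G U x := by
  simp only [dg_sum]; rw [Finset.sum_union hd]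

theorem B16 (h : G5 G) : Bd G 16 29 := by
  have h30 : Bd G 16 30 := stepA h (B15 h) 30 3 3 (by norm_num) (by norm_num) (by norm_num)
  intro S hc he
  have he' := ev h30 S hc he
  have hm := mindeg (B15 h) S hc 2 (by omega)
  have hS : ∀ x ∈ S, dg G S x = 5 ∨ dg G S x = 4 ∨ dg G S x = 3 := by
    intro x hx
    have := ball h S x hx 3 hm
    have := hm x hx
    omega
  have spl : ∀ f : V → ℕ, ∑ x ∈ S, f x = ∑ x ∈ cl G S 5, f x + ∑ x ∈ cl G S 4, f x + ∑ x ∈ cl G S 3, f x := by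
    intro f
    unfold cl
    simp only [Finset.sum_filter]
    rw [← Finset.sum_add_distrib, ← Finset.sum_add_distrib]
    apply Finset.sum_congr rfl
    intro x hx
    rcases hS x hx with e | e | e <;> simp [e]
  have cnt : S.card = (cl G S 5).card + (cl G S 4).card + (cl G S 3).card := by simpa using spl (fun _ => 1)
  have esum : es G S = 5 * (cl G S 5).card + 4 * (cl G S 4).card + 3 * (cl G S 3).card := by
    rw [← sum_cl, ← sum_cl, ← sum_cl]; exact spl _
  have dspl : ∀ x, dg G S x = dg G (cl G S 5) x + dg G (cl G S 4) x + dg G (cl G S 3) x := by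
    intro x; simp only [dg_sum]; exact spl _
  have bal : ∀ x ∈ S, 3 * dg G S x + dg G (cl G S 4) x + 2 * dg G (cl G S 5) x + 1 ≤ 16 := by
    intro x hx
    have h1 := ball_eq h S x hx
    have h2 : ∑ y ∈ S.filter (fun y => G.Adj x y), dg G S y = 3 * dg G S x + dg G (cl G S 4) x + 2 * dg G (cl G S 5) x := by
      rw [Finset.sum_filter, spl]
      have g : ∀ k, ∑ y ∈ cl G S k, (if G.Adj x y then dg G S y else 0) = k * dg G (cl G S k) x := by
        intro k
        rw [dg_sum, Finset.mul_sum]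
        apply Finset.sum_congr rfl
        intro y hy
        rw [(mem_cl.1 hy).2]; simp
      rw [g, g, g, dspl]; ring
    omega
  have c5 : ∀ x ∈ S, dg G S x = 5 → dg G (cl G S 5) x = 0 ∧ dg G (cl G S 4) x = 0 := by
    intro x hx hd; have := bal x hx; omega
  have c4 : ∀ x ∈ S, dg G S x = 4 → dg G (cl G S 4) x ≤ 3 ∧ dg G (cl G S 5) x = 0 := by
    intro x hx hd
    have hb := bal x hx
    refine ⟨by omega, ?_⟩
    by_contra hne
    obtain ⟨y, hy, hxy⟩ := nb1 (Nat.one_le_iff_ne_zero.2 hne)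
    have h0 := (c5 y (mem_cl.1 hy).1 (mem_cl.1 hy).2).2
    have : x ∈ (cl G S 4).filter (fun z => G.Adj y z) := Finset.mem_filter.2 ⟨mem_cl.2 ⟨hx, hd⟩, hxy.symm⟩
    rw [Finset.card_eq_zero.1 h0] at this
    simp at this
  have hs : (cl G S 5).card ≤ 1 := by
    have h1 := pair_lemma h S (cl G S 5)
    have h2 := dg_dc G S (cl G S 5)
    rw [sum_cl] at h2
    have h3 := spl (dg G (cl G S 5))
    have h4 := spl (fun x => dg G (cl G S 5) x * dg G (cl G S 5) x)
    have z5 : ∑ x ∈ cl G S 5, dg G (cl G S 5) x = 0 := Finset.sum_eq_zero (fun x hx => (c5 x (mem_cl.1 hx).1 (mem_cl.1 hx).2).1)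
    have z4 : ∑ x ∈ cl G S 4, dg G (cl G S 5) x = 0 := Finset.sum_eq_zero (fun x hx => (c4 x (mem_cl.1 hx).1 (mem_cl.1 hx).2).2)
    have hq := sum_sq (cl G S 3) (dg G (cl G S 5)) 3 2 (fun x _ => q_aux _ 1)
    have hle : (cl G S 5).card ≤ 5 := by omega
    generalize (cl G S 5).card = s at *
    interval_cases s <;> omega
  rcases Nat.lt_or_ge (cl G S 5).card 1 with h0 | h1
  · have e5 : cl G S 5 = ∅ := Finset.card_eq_zero.1 (by omega)
    have hS' : ∀ x ∈ S, dg G S x = 4 ∨ dg G S x = 3 := by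
      intro x hx
      rcases hS x hx with e | e
      · have : x ∈ cl G S 5 := mem_cl.2 ⟨hx, e⟩
        rw [e5] at this; simp at this
      · exact e
    have k4 : (cl G S 4).card = 10 := by omega
    have k3 : (cl G S 3).card = 6 := by omega
    have p := (pair2 h S (by norm_num) hS').2
    have hb3 : ∑ x ∈ cl G S 3, dg G (cl G S 4) x ≤ 3 * (cl G S 3).card := by
      rw [← sum_cl]
      exact Finset.sum_le_sum (fun x _ => dg_le_dg S 4 x)
    obtain ⟨x, hx, hk⟩ := ex_big (cl G S 4) (dg G (cl G S 4)) 2 (by rw [k4]; unfold es at p; omega)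
    obtain ⟨a, ha, b, hb, c, hc', hab, hac, hbc, xa, xb, xc⟩ := nb3 hk
    refine case_16b h S hS' k4 k3 (fun v hv hd => (c4 v hv hd).1) x a b c hx ha hb hc' ?_ xa xb xc
    simp [hab, hac, hbc, xa.ne, xb.ne, xc.ne]
  · exact case_16a h S hS (by omega) (by omega) (by omega) (fun v hv hd => (c5 v hv hd).2) (fun v hv hd => (c4 v hv hd).1)

theorem es_ge (S : Finset V) (k : ℕ) (hk : ∀ x ∈ S, k ≤ dg G S x) : k * S.card ≤ es G S := by
  have := Finset.sum_le_sum hk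
  rw [Finset.sum_const, smul_eq_mul, mul_comm] at this
  exact this

theorem B17 (h : G5 G) : Bd G 17 32 := by
  have h34 : Bd G 17 34 := stepA h (B16 h) 34 5 3 (by norm_num) (by norm_num) (by norm_num)
  intro S hc he
  have hm := es_ge S 4 (mindeg (B16 h) S hc 3 (by omega))
  exact h34 S hc (by omega)

theorem B18 (h : G5 G) : Bd G 18 35 := by
  have h34 : Bd G 18 36 := stepA h (B17 h) 36 4 3 (by norm_num) (by norm_num) (by norm_num)
  intro S hc he
  have hm := es_ge S 4 (mindeg (B17 h) S hc 3 (by omega))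
  exact h34 S hc (by omega)

theorem B19 (h : G5 G) : Bd G 19 39 := stepA h (B18 h) 39 4 4 (by norm_num) (by norm_num) (by norm_num)
theorem B20 (h : G5 G) : Bd G 20 42 := stepA h (B19 h) 42 3 4 (by norm_num) (by norm_num) (by norm_num)

theorem s54 (h : G5 G) (n m : ℕ) (hB : Bd G n m) (S : Finset V) (hn : n ≤ 23) (hc : S.card = n + 1)
    (he : 2 * m + 6 ≤ es G S) : ∀ x ∈ S, dg G S x = 5 ∨ dg G S x = 4 := by
  have hm := mindeg hB S hc 3 (by omega)
  intro x hx
  have := ball h S x hx 4 hm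
  have := hm x hx
  omega

theorem ball54 (h : G5 G) (S : Finset V) (hS : ∀ x ∈ S, dg G S x = 5 ∨ dg G S x = 4) (x : V) (hx : x ∈ S) :
    4 * dg G S x + dg G (cl G S 5) x + (far G S x).card + 1 = S.card := ball2 h S 4 hS x hx

theorem B21 (h : G5 G) : Bd G 21 45 := by
  have h46 : Bd G 21 46 := stepA h (B20 h) 46 4 4 (by norm_num) (by norm_num) (by norm_num)
  intro S hc he
  have he' := ev h46 S hc he
  have hS := s54 h _ _ (B20 h) S (by norm_num) hc (by omega)
  have h2 := count2 S (by norm_num) hS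
  refine case_21 h S hS (by omega) (by omega) (fun v hv hd => ?_)
  have := ball54 h S hS v hv
  omega

theorem mtch (T : Finset V) (n : ℕ) (hc : T.card = n + 2) (h1 : ∀ x ∈ T, dg G T x = 1) :
    ∃ a ∈ T, ∃ b ∈ T, G.Adj a b ∧ ∃ U ⊆ T, U.card = n ∧ a ∉ U ∧ b ∉ U ∧ ∀ x ∈ U, dg G U x = 1 := by
  obtain ⟨a, ha⟩ := Finset.card_pos.1 (show 0 < T.card by omega)
  obtain ⟨b, hb, hab⟩ := nb1 (le_of_eq (h1 a ha).symm)
  have hb' : b ∈ T.erase a := Finset.mem_erase.2 ⟨hab.ne', hb⟩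
  have uniq : ∀ x ∈ T, ∀ y ∈ T, ∀ z ∈ T, G.Adj x y → G.Adj x z → y = z := by
    intro x hx y hy z hz xy xz
    have := Finset.card_le_one.1 (le_of_eq (h1 x hx))
    exact this y (Finset.mem_filter.2 ⟨hy, xy⟩) z (Finset.mem_filter.2 ⟨hz, xz⟩)
  refine ⟨a, ha, b, hb, hab, (T.erase a).erase b, ?_, ?_, ?_, ?_, ?_⟩
  · exact (Finset.erase_subset _ _).trans (Finset.erase_subset _ _)
  · rw [Finset.card_erase_of_mem hb', Finset.card_erase_of_mem ha]; omega
  · simp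
  · simp
  · intro x hx
    simp only [Finset.mem_erase] at hx
    have e1 := dg_erase G T a x ha
    have e2 := dg_erase G (T.erase a) b x hb'
    have n1 : ¬ G.Adj x a := fun e => hx.1 (uniq a ha x hx.2.2 b hb e.symm hab)
    have n2 : ¬ G.Adj x b := fun e => hx.2.1 (uniq b hb x hx.2.2 a ha e.symm hab.symm)
    rw [if_neg n1] at e1
    rw [if_neg n2] at e2
    have := h1 x hx.2.2
    omega

theorem B22 (h : G5 G) : Bd G 22 48 := by
  have h46 : Bd G 22 49 := stepA h (B21 h) 49 4 4 (by norm_num) (by norm_num) (by norm_num)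
  intro S hc he
  have he' := ev h46 S hc he
  have hS := s54 h _ _ (B21 h) S (by norm_num) hc (by omega)
  have h2 := count2 S (by norm_num) hS
  have k5 : (cl G S 5).card = 8 := by omega
  have k4 : (cl G S 4).card = 14 := by omega
  have hk : ∀ v ∈ S, dg G S v = 5 → dg G (cl G S 5) v ≤ 1 := by
    intro v hv hd
    have := ball54 h S hS v hv
    omega
  obtain ⟨p1, p2⟩ := pair2 h S (by norm_num) hS
  have q1 := sum_sq (cl G S 4) (dg G (cl G S 5)) 5 6 (fun x _ => q_aux _ 2)
  have q2 := sum_sq (cl G S 5) (dg G (cl G S 5)) 1 0 (fun x _ => q_aux _ 0)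
  have e5 : ∑ x ∈ cl G S 5, dg G (cl G S 5) x = es G (cl G S 5) := rfl
  obtain ⟨k, hk2⟩ := es_even G (cl G S 5)
  rw [k5] at p1 p2
  rw [k4] at q1
  have K : 8 ≤ es G (cl G S 5) := by omega
  have h1 : ∀ x ∈ cl G S 5, dg G (cl G S 5) x = 1 := by
    intro x hx
    by_contra hne
    have : ∑ x ∈ cl G S 5, dg G (cl G S 5) x < ∑ x ∈ cl G S 5, 1 := by
      refine Finset.sum_lt_sum (fun y hy => hk y (mem_cl.1 hy).1 (mem_cl.1 hy).2) ⟨x, hx, ?_⟩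
      have := hk x (mem_cl.1 hx).1 (mem_cl.1 hx).2
      omega
    simp at this
    omega
  obtain ⟨a, ha, b, hb, ab, U, hU, cU, naU, nbU, hU1⟩ := mtch (cl G S 5) 6 k5 h1
  obtain ⟨c, hc, d, hd, cd, U', hU', cU', ncU, ndU, hU1'⟩ := mtch U 4 cU hU1
  obtain ⟨e, he, f, hf, ef, W, hW, cW, neW, nfW, hW1⟩ := mtch U' 2 cU' hU1'
  obtain ⟨i, hi, j, hj, ij, -⟩ := mtch W 0 cW hW1
  have wU : ∀ x ∈ W, x ∈ U := fun x hx => hU' (hW hx)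
  refine case_22 h S hS k5 k4 hk a b c d e f i j ha hb (hU hc) (hU hd) (hU (hU' he)) (hU (hU' hf)) (hU (wU i hi)) (hU (wU j hj)) ?_ ab cd ef ij
  have hi' := hW hi
  have hj' := hW hj
  have g1 : ∀ {P : Finset V} {x y : V}, x ∉ P → y ∈ P → x ≠ y := fun hx hy e => hx (e ▸ hy)
  simp [ab.ne, cd.ne, ef.ne, ij.ne, g1 naU hc, g1 naU hd, g1 naU (hU' he), g1 naU (hU' hf), g1 naU (wU i hi), g1 naU (wU j hj),
    g1 nbU hc, g1 nbU hd, g1 nbU (hU' he), g1 nbU (hU' hf), g1 nbU (wU i hi), g1 nbU (wU j hj),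
    g1 ncU he, g1 ncU hf, g1 ncU hi', g1 ncU hj', g1 ndU he, g1 ndU hf, g1 ndU hi', g1 ndU hj', g1 neW hi, g1 neW hj, g1 nfW hi, g1 nfW hj]

theorem B23 (h : G5 G) : Bd G 23 51 := by
  have h46 : Bd G 23 52 := stepA h (B22 h) 52 4 4 (by norm_num) (by norm_num) (by norm_num)
  intro S hc he
  have he' := ev h46 S hc he
  have hS := s54 h _ _ (B22 h) S (by norm_num) hc (by omega)
  have h2 := count2 S (by norm_num) hS
  have k5 : (cl G S 5).card = 10 := by omega
  have k4 : (cl G S 4).card = 13 := by omega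
  have hk : ∀ v ∈ S, dg G S v = 5 → dg G (cl G S 5) v ≤ 2 := by
    intro v hv hd
    have := ball54 h S hS v hv
    omega
  obtain ⟨p1, p2⟩ := pair2 h S (by norm_num) hS
  have q1 := sum_sq (cl G S 4) (dg G (cl G S 5)) 7 12 (fun x _ => q_aux _ 3)
  have q2 := sum_sq (cl G S 5) (dg G (cl G S 5)) 1 0 (fun x _ => q_aux _ 0)
  have e5 : ∑ x ∈ cl G S 5, dg G (cl G S 5) x = es G (cl G S 5) := rfl
  rw [k5] at p1 p2
  rw [k4] at q1
  obtain ⟨x, hx, hx2⟩ := ex_big (cl G S 5) (dg G (cl G S 5)) 1 (by omega)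
  obtain ⟨a, ha, b, hb, hab, xa, xb⟩ := nb2 hx2
  refine case_23 h S hS k5 k4 hk x a b hx ha hb ?_ xa xb
  simp [hab, xa.ne, xb.ne]

theorem B24 (h : G5 G) : Bd G 24 55 := stepA h (B23 h) 55 4 4 (by norm_num) (by norm_num) (by norm_num)
end
end TS

namespace TS
section
variable {V : Type} [DecidableEq V] {G : SimpleGraph V} [DecidableRel G.Adj]

theorem path_lemma (h : G5 G) (T : Finset V) (h2 : ∀ x ∈ T, dg G T x ≤ 2) (hs : 3 * T.card < 2 * es G T) :
    ∃ a ∈ T, ∃ b ∈ T, ∃ c ∈ T, ∃ d ∈ T, ∃ e ∈ T, [a, b, c, d, e].Nodup ∧ G.Adj a b ∧ G.Adj b c ∧ G.Adj c d ∧ G.Adj d e := by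
  have hg : ∃ x ∈ T, dg G T x = 2 ∧ ∀ y ∈ T, G.Adj x y → dg G T y = 2 := by
    by_contra hno
    push Not at hno
    set W := T.filter (fun x => dg G T x ≤ 1) with hW
    have k1 : ∀ x ∈ T, 1 ≤ (if dg G T x ≤ 1 then 1 else 0) + dg G W x := by
      intro x hx
      by_cases hx1 : dg G T x ≤ 1
      · simp [hx1]
      · have := h2 x hx
        obtain ⟨y, hy, xy, hy2⟩ := hno x hx (by omega)
        have := h2 y hy
        have : 0 < dg G W x := Finset.card_pos.2 ⟨y, Finset.mem_filter.2 ⟨Finset.mem_filter.2 ⟨hy, by omega⟩, xy⟩⟩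
        omega
    have k2 := Finset.sum_le_sum k1
    rw [Finset.sum_add_distrib, dg_dc, ← Finset.sum_filter, ← Finset.sum_add_distrib, Finset.sum_const, smul_eq_mul, mul_one] at k2
    rw [← hW] at k2
    have k3 : ∑ x ∈ W, (1 + dg G T x) ≤ ∑ x ∈ W, (4 - 2 * dg G T x) := by
      apply Finset.sum_le_sum
      intro x hx
      have := (Finset.mem_filter.1 hx).2
      omega
    have k4 : ∑ x ∈ W, (4 - 2 * dg G T x) ≤ ∑ x ∈ T, (4 - 2 * dg G T x) :=
      Finset.sum_le_sum_of_subset (Finset.filter_subset _ _)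
    have k5 : ∑ x ∈ T, (4 - 2 * dg G T x) + 2 * ∑ x ∈ T, dg G T x = 4 * T.card := by
      rw [Finset.mul_sum, ← Finset.sum_add_distrib, Finset.sum_congr rfl (fun x hx => show 4 - 2 * dg G T x + 2 * dg G T x = 4 by have := h2 x hx; omega), Finset.sum_const, smul_eq_mul, mul_comm]
    have k6 : ∑ x ∈ T, dg G T x = es G T := rfl
    omega
  obtain ⟨x, hx, hx2, hxn⟩ := hg
  obtain ⟨a, ha, b, hb, hab, xa, xb⟩ := nb2 (le_of_eq hx2.symm)
  have oth : ∀ a ∈ T, G.Adj x a → ∃ a' ∈ T, a' ≠ x ∧ G.Adj a a' := by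
    intro a ha xa
    have h3 := dg_erase G T x a hx
    rw [if_pos xa.symm, hxn a ha xa] at h3
    obtain ⟨a', ha', e⟩ := nb1 (show 1 ≤ dg G (T.erase x) a by omega)
    exact ⟨a', Finset.mem_of_mem_erase ha', Finset.ne_of_mem_erase ha', e⟩
  obtain ⟨a', ha', na, aa⟩ := oth a ha xa
  obtain ⟨b', hb', nb, bb⟩ := oth b hb xb
  refine ⟨a', ha', a, ha, x, hx, b, hb, b', hb', ?_, aa.symm, xa.symm, xb, bb⟩
  have n1 : a' ≠ b := by rintro rfl; exact h.tri _ _ _ xa aa xb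
  have n2 : b' ≠ a := by rintro rfl; exact h.tri _ _ _ xb bb xa
  have n3 : a' ≠ b' := by
    rintro rfl
    rcases h.quad x a a' b xa aa bb.symm xb.symm with e | e
    · exact na e.symm
    · exact hab e
  simp [aa.ne', na, n1, n3, xa.ne', hab, n2.symm, xb.ne, nb.symm, bb.ne]

theorem k2_24 (h : G5 G) (S : Finset V) (hc : S.card = 24) (hS : ∀ x ∈ S, dg G S x = 5 ∨ dg G S x = 4) (he : es G S = 108) :
    ∀ y ∈ cl G S 5, 2 ≤ dg G (cl G S 5) y := by
  have h2 := count2 S (by norm_num) hS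
  have k5 : (cl G S 5).card = 12 := by omega
  have k4 : (cl G S 4).card = 12 := by omega
  have hk : ∀ v ∈ S, dg G S v = 5 → dg G (cl G S 5) v ≤ 3 := by
    intro v hv hd
    have := ball54 h S hS v hv
    omega
  intro y hy
  by_contra hlt
  have hy1 : dg G (cl G S 5) y ≤ 1 := by omega
  have n54 : ∀ {a b : V}, a ∈ cl G S 5 → b ∈ cl G S 4 → a ≠ b := by
    rintro a b ha hb rfl
    have := (mem_cl.1 ha).2
    have := (mem_cl.1 hb).2
    omega
  by_cases h3 : ∃ x ∈ cl G S 5, dg G (cl G S 5) x = 3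
  · obtain ⟨x, hx, hx3⟩ := h3
    obtain ⟨hxS, hx5⟩ := mem_cl.1 hx
    have hyS := (mem_cl.1 hy).1
    have hbx := ball54 h S hS x hxS
    have hd := dg2 S (by norm_num) hS x
    have hx4 : dg G (cl G S 4) x = 2 := by omega
    have hf : far G S x = ∅ := Finset.card_eq_zero.1 (by omega)
    have hyf : y ∉ far G S x := by rw [hf]; simp
    have hyx : y ≠ x := by rintro rfl; omega
    by_cases xy : G.Adj x y
    · have e := dg_erase G (cl G S 5) y x hy
      rw [if_pos xy] at e
      obtain ⟨a, ha, b, hb, hab, xa, xb⟩ := nb2 (show 2 ≤ dg G ((cl G S 5).erase y) x by omega)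
      obtain ⟨p, hp, q, hq, hpq, xp, xq⟩ := nb2 (show 2 ≤ dg G (cl G S 4) x by omega)
      obtain ⟨nya, ha⟩ := Finset.mem_erase.1 ha
      obtain ⟨nyb, hb⟩ := Finset.mem_erase.1 hb
      refine case_A h S hS k5 k4 hk y x a b p q hy hx ha hb hp hq ?_ xy.symm xa xb xp xq hy1
      simp [hyx, nya.symm, nyb.symm, n54 hy hp, n54 hy hq, xa.ne, xb.ne, xp.ne, xq.ne, hab, n54 ha hp, n54 ha hq, n54 hb hp, n54 hb hq, hpq]
    · have hz : ∃ z ∈ S, G.Adj x z ∧ G.Adj z y := by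
        by_contra hno
        push Not at hno
        exact hyf (Finset.mem_filter.2 ⟨hyS, hyx, xy, hno⟩)
      obtain ⟨z, hzS, xz, zy⟩ := hz
      have nadj : ∀ {a : V}, G.Adj x a → y ≠ a := by rintro a xa rfl; exact xy xa
      rcases hS z hzS with hz5 | hz4
      · have hz : z ∈ cl G S 5 := mem_cl.2 ⟨hzS, hz5⟩
        have e := dg_erase G (cl G S 5) z x hz
        rw [if_pos xz] at e
        obtain ⟨a, ha, b, hb, hab, xa, xb⟩ := nb2 (show 2 ≤ dg G ((cl G S 5).erase z) x by omega)
        obtain ⟨p, hp, q, hq, hpq, xp, xq⟩ := nb2 (show 2 ≤ dg G (cl G S 4) x by omega)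
        obtain ⟨nza, ha⟩ := Finset.mem_erase.1 ha
        obtain ⟨nzb, hb⟩ := Finset.mem_erase.1 hb
        refine case_Bf h S hS k5 k4 hk y x z a b p q hy hx hz ha hb hp hq ?_ xz xa xb xp xq zy.symm hy1
        simp [hyx, nadj xz, nadj xa, nadj xb, nadj xp, nadj xq, xz.ne, xa.ne, xb.ne, xp.ne, xq.ne, nza.symm, nzb.symm, hab, hpq,
          n54 hz hp, n54 hz hq, n54 ha hp, n54 ha hq, n54 hb hp, n54 hb hq]
      · have hz : z ∈ cl G S 4 := mem_cl.2 ⟨hzS, hz4⟩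
        have e := dg_erase G (cl G S 4) z x hz
        rw [if_pos xz] at e
        obtain ⟨a, ha, b, hb, c, hc', hab, hac, hbc, xa, xb, xc⟩ := nb3 (show 3 ≤ dg G (cl G S 5) x by omega)
        obtain ⟨p, hp, xp⟩ := nb1 (show 1 ≤ dg G ((cl G S 4).erase z) x by omega)
        obtain ⟨nzp, hp⟩ := Finset.mem_erase.1 hp
        refine case_Bg h S hS k5 k4 hk y x a b c z p hy hx ha hb hc' hz hp ?_ xa xb xc xz xp zy.symm hy1
        simp [hyx, nadj xz, nadj xa, nadj xb, nadj xc, nadj xp, xz.ne, xa.ne, xb.ne, xc.ne, xp.ne, hab, hac, hbc, nzp.symm,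
          n54 ha hz, n54 ha hp, n54 hb hz, n54 hb hp, n54 hc' hz, n54 hc' hp]
  · push Not at h3
    have hk2 : ∀ v ∈ cl G S 5, dg G (cl G S 5) v ≤ 2 := by
      intro v hv
      have := hk v (mem_cl.1 hv).1 (mem_cl.1 hv).2
      have := h3 v hv
      omega
    obtain ⟨p1, p2⟩ := pair2 h S (by norm_num) hS
    have q1 := sum_sq (cl G S 4) (dg G (cl G S 5)) 7 12 (fun x _ => q_aux _ 3)
    have q2 := sum_sq (cl G S 5) (dg G (cl G S 5)) 3 2 (fun x _ => q_aux _ 1)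
    have e5 : ∑ x ∈ cl G S 5, dg G (cl G S 5) x = es G (cl G S 5) := rfl
    rw [k5] at p1 p2 q2
    rw [k4] at q1
    obtain ⟨a, ha, b, hb, c, hc', d, hd, e, he', hn, ab, bc, cd, de⟩ := path_lemma h (cl G S 5) hk2 (by omega)
    exact case_M2 h S hS k5 k4 (fun v hv hd => hk2 v (mem_cl.2 ⟨hv, hd⟩)) a b c d e ha hb hc' hd he' hn ab bc cd de

theorem min3 (h : G5 G) (S : Finset V) (hc : S.card = 25) (he : es G S = 114) : ∀ x ∈ S, 3 ≤ dg G S x :=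
  mindeg (B24 h) S hc 2 (by omega)

theorem H24 (h : G5 G) (S : Finset V) (hc : S.card = 25) (he : es G S = 114) (v : V) (hv : v ∈ S) (hd : dg G S v = 3) :
    (S.erase v).card = 24 ∧ es G (S.erase v) = 108 ∧ ∀ x ∈ S.erase v, dg G (S.erase v) x = 5 ∨ dg G (S.erase v) x = 4 := by
  have e1 := es_erase G S v hv
  have c1 : (S.erase v).card = 24 := by rw [Finset.card_erase_of_mem hv]; omega
  exact ⟨c1, by omega, s54 h _ _ (B23 h) _ (by norm_num) c1 (by omega)⟩

theorem max35 (h : G5 G) (S : Finset V) (hc : S.card = 25) (he : es G S = 114) (v : V) (hv : v ∈ S) (hd : dg G S v = 3) :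
    ∀ y ∈ S, dg G S y ≤ 5 := by
  obtain ⟨c1, e1, hS⟩ := H24 h S hc he v hv hd
  intro y hy
  by_contra hlt
  have hyv : y ≠ v := by rintro rfl; omega
  have hyH : y ∈ S.erase v := Finset.mem_erase.2 ⟨hyv, hy⟩
  have e2 := dg_erase G S v y hv
  have e3 := hS y hyH
  split_ifs at e2 with yv
  · have hy5 : dg G (S.erase v) y = 5 := by omega
    have hk := k2_24 h _ c1 hS e1 y (mem_cl.2 ⟨hyH, hy5⟩)
    have hb := ball54 h _ hS y hyH
    have e4 := dg_erase G S y v hy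
    rw [if_pos yv.symm] at e4
    obtain ⟨a, ha, b, hb', hab, va, vb⟩ := nb2 (show 2 ≤ dg G (S.erase y) v by omega)
    have inf : ∀ a ∈ S.erase y, G.Adj v a → a ∈ far G (S.erase v) y := by
      intro a ha va
      obtain ⟨nay, haS⟩ := Finset.mem_erase.1 ha
      refine Finset.mem_filter.2 ⟨Finset.mem_erase.2 ⟨va.ne', haS⟩, nay, fun e => h.tri v y a yv.symm e va, fun z hz e1 e2 => ?_⟩
      rcases h.quad v y z a yv.symm e1 e2 va.symm with e | e
      · exact (Finset.mem_erase.1 hz).1 e.symm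
      · exact nay e.symm
    have : 1 < (far G (S.erase v) y).card := Finset.one_lt_card.2 ⟨a, inf a ha va, b, inf b hb' vb, hab⟩
    omega
  · omega

def St (G : SimpleGraph V) [DecidableRel G.Adj] (S : Finset V) : Prop :=
  ∃ x ∈ S, dg G S x = 5 ∧ 3 ≤ dg G (cl G S 5) x ∧ ∀ y ∈ S, G.Adj x y → 4 ≤ dg G S y

theorem star35 (h : G5 G) (S : Finset V) (hc : S.card = 25) (he : es G S = 114) (v : V) (hv : v ∈ S) (hd : dg G S v = 3) : St G S := by
  obtain ⟨c1, e1, hS⟩ := H24 h S hc he v hv hd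
  have hM := max35 h S hc he v hv hd
  have hK := k2_24 h _ c1 hS e1
  have h2 := count2 _ (by norm_num) hS
  have er := fun x => dg_erase G S v x hv
  set H := S.erase v with hH
  by_contra hno
  unfold St at hno
  push Not at hno
  have inS : ∀ x ∈ H, x ∈ S := fun x hx => Finset.mem_of_mem_erase hx
  have nav : ∀ x ∈ cl G H 5, ¬ G.Adj x v := by
    intro x hx e
    obtain ⟨hx1, hx2⟩ := mem_cl.1 hx
    have := er x
    rw [if_pos e] at this
    have := hM x (inS x hx1)
    omega
  set N := H.filter (fun x => G.Adj v x) with hN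
  have N4 : ∀ x ∈ N, dg G H x = 4 ∧ dg G S x = 5 := by
    intro x hx
    obtain ⟨hx1, hx2⟩ := Finset.mem_filter.1 hx
    have h1 := er x
    rw [if_pos hx2.symm] at h1
    have := hM x (inS x hx1)
    have := hS x hx1
    omega
  have P5 : ∀ x ∈ cl G H 5, dg G S x = 5 := by
    intro x hx
    have h1 := er x
    rw [if_neg (nav x hx)] at h1
    rw [h1]; exact (mem_cl.1 hx).2
  have hsub : cl G H 5 ∪ N ⊆ cl G S 5 := by
    intro x hx
    rcases Finset.mem_union.1 hx with hx | hx
    · exact mem_cl.2 ⟨inS x (mem_cl.1 hx).1, P5 x hx⟩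
    · exact mem_cl.2 ⟨inS x (Finset.mem_filter.1 hx).1, (N4 x hx).2⟩
  have hdis : Disjoint (cl G H 5) N := by
    rw [Finset.disjoint_left]
    intro x hx hx'
    have := (mem_cl.1 hx).2
    have := N4 x hx'
    omega
  have main : ∀ x ∈ cl G H 5, dg G (cl G H 5) x = 2 ∧ dg G N x = 0 := by
    intro x hx
    have hxS := inS x (mem_cl.1 hx).1
    have h1 := dg_dis (G := G) _ _ hdis x
    have h2 := dg_mono G hsub x
    have h3 := hK x hx
    have h4 : dg G (cl G S 5) x ≤ 2 := by
      by_contra hlt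
      obtain ⟨y, hy, xy, hy4⟩ := hno x hxS (P5 x hx) (by omega)
      have hyH : y ∈ H := Finset.mem_erase.2 ⟨fun e => nav x hx (e ▸ xy), hy⟩
      have := hS y hyH
      have := er y
      omega
    omega
  have k5 : (cl G H 5).card = 12 := by omega
  have k4 : (cl G H 4).card = 12 := by omega
  have hNc : N.card = 3 := by
    have h1 := dg_erase G S v v hv
    rw [if_neg (G.loopless.irrefl v), hd] at h1
    exact h1.symm
  have hN4 : N ⊆ cl G H 4 := fun x hx => mem_cl.2 ⟨(Finset.mem_filter.1 hx).1, (N4 x hx).1⟩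
  obtain ⟨p1, p2⟩ := pair2 h H (by norm_num) hS
  have hK' : es G (cl G H 5) = 24 := by
    unfold es
    rw [Finset.sum_congr rfl (fun x hx => (main x hx).1), Finset.sum_const, k5]; rfl
  have zN : ∑ x ∈ N, dg G (cl G H 5) x = 0 := by
    rw [dg_dc]; exact Finset.sum_eq_zero (fun x hx => (main x hx).2)
  have sp := Finset.sum_sdiff (f := dg G (cl G H 5)) hN4
  have sp2 := Finset.sum_sdiff (f := fun x => dg G (cl G H 5) x * dg G (cl G H 5) x) hN4
  have cF : (cl G H 4 \ N).card = 9 := by rw [Finset.card_sdiff_of_subset hN4]; omega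
  have q1 := sum_sq (cl G H 4 \ N) (dg G (cl G H 5)) 7 12 (fun x _ => q_aux _ 3)
  have q2 := sum_sq (cl G H 5) (dg G (cl G H 5)) 3 2 (fun x _ => q_aux _ 1)
  have e5 : ∑ x ∈ cl G H 5, dg G (cl G H 5) x = es G (cl G H 5) := rfl
  rw [k5] at p1 p2 q2
  rw [cF] at q1
  omega

theorem star45 (h : G5 G) (S : Finset V) (hc : S.card = 25) (he : es G S = 114) (hS : ∀ x ∈ S, dg G S x = 5 ∨ dg G S x = 4) : St G S := by
  by_contra hno
  unfold St at hno
  push Not at hno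
  have h2 := count2 _ (by norm_num) hS
  have k5 : (cl G S 5).card = 14 := by omega
  have k4 : (cl G S 4).card = 11 := by omega
  have hk : ∀ x ∈ cl G S 5, dg G (cl G S 5) x ≤ 2 := by
    intro x hx
    by_contra hlt
    obtain ⟨y, hy, xy, hy4⟩ := hno x (mem_cl.1 hx).1 (mem_cl.1 hx).2 (by omega)
    have := hS y hy
    omega
  have hk3 : ∀ x ∈ cl G S 5, 3 ≤ dg G (cl G S 4) x := by
    intro x hx
    have := dg2 S (by norm_num) hS x
    have := hk x hx
    have := (mem_cl.1 hx).2
    omega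
  have p2 := (pair2 h S (by norm_num) hS).2
  have hb4 : ∑ x ∈ cl G S 4, dg G (cl G S 5) x ≤ 4 * (cl G S 4).card := by
    rw [← sum_cl]
    exact Finset.sum_le_sum (fun x _ => dg_le_dg S 5 x)
  obtain ⟨a, ha, b, hb, c, hc', d, hd, e, he', hn, ab, bc, cd, de⟩ := path_lemma h (cl G S 5) hk (by omega)
  simp only [List.nodup_cons, List.mem_cons, List.not_mem_nil, or_false, not_or, List.nodup_nil, and_true, not_false_eq_true] at hn
  obtain ⟨⟨n1, n2, n3, n4⟩, ⟨n5, n6, n7⟩, ⟨n8, n9⟩, n10⟩ := hn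
  set T : Finset V := {a, b, c, d, e} with hT
  have sumT : ∀ f : V → ℕ, ∑ x ∈ T, f x = f a + f b + f c + f d + f e := by
    intro f
    rw [hT, Finset.sum_insert (by simp [*]), Finset.sum_insert (by simp [*]), Finset.sum_insert (by simp [*]), Finset.sum_insert (by simp [*]), Finset.sum_singleton]
    ring
  have cT : T.card = 5 := by have := sumT (fun _ => 1); simpa using this
  have TS5 : ∀ x ∈ T, x ∈ cl G S 5 := by
    intro x hx
    simp only [hT, Finset.mem_insert, Finset.mem_singleton] at hx
    rcases hx with rfl | rfl | rfl | rfl | rfl <;> assumption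
  have hdis : Disjoint (cl G S 4) T := by
    rw [Finset.disjoint_left]
    intro x hx hx'
    have := (mem_cl.1 hx).2
    have := (mem_cl.1 (TS5 x hx')).2
    omega
  have p := pair_lemma h (cl G S 4 ∪ T) T
  rw [Finset.sum_union hdis, Finset.sum_union hdis, cT] at p
  have mT : a ∈ T ∧ b ∈ T ∧ c ∈ T ∧ d ∈ T ∧ e ∈ T := by simp [hT]
  obtain ⟨ma, mb, mc, md, me⟩ := mT
  have d1 : ∀ x y, y ∈ T → G.Adj x y → 1 ≤ dg G T x := fun x y hy e => Finset.card_pos.2 ⟨y, Finset.mem_filter.2 ⟨hy, e⟩⟩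
  have d2 : ∀ x y z, y ∈ T → z ∈ T → y ≠ z → G.Adj x y → G.Adj x z → 2 ≤ dg G T x := fun x y z hy hz n e e' =>
    Finset.one_lt_card.2 ⟨y, Finset.mem_filter.2 ⟨hy, e⟩, z, Finset.mem_filter.2 ⟨hz, e'⟩, n⟩
  have ta := d1 a b mb ab
  have tb := d2 b a c ma mc n2 ab.symm bc
  have tc := d2 c b d mb md n6 bc.symm cd
  have td := d2 d c e mc me n9 cd.symm de
  have te := d1 e d md de.symm
  have s1 := sumT (fun x => dg G T x * dg G T x)
  have s2 := sumT (dg G (cl G S 4))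
  have := hk3 a ha
  have := hk3 b hb
  have := hk3 c hc'
  have := hk3 d hd
  have := hk3 e he'
  have dc := dg_dc G (cl G S 4) T
  have q := sum_sq (cl G S 4) (dg G T) 3 2 (fun x _ => q_aux _ 1)
  rw [k4] at q
  have ua := Nat.mul_le_mul ta ta
  have ub := Nat.mul_le_mul tb tb
  have uc := Nat.mul_le_mul tc tc
  have ud := Nat.mul_le_mul td td
  have ue := Nat.mul_le_mul te te
  omega

theorem six4 (h : G5 G) (S : Finset V) (hc : S.card = 25) (hm : ∀ x ∈ S, 4 ≤ dg G S x) : 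
    ∀ x ∈ S, dg G S x = 6 → ∀ y ∈ S, G.Adj x y → dg G S y = 4 := by
  intro x hx hx6 y hy xy
  by_contra hne
  have hb := ball_eq h S x hx
  have hlt : ∑ z ∈ S.filter (fun z => G.Adj x z), 4 < ∑ z ∈ S.filter (fun z => G.Adj x z), dg G S z := by
    refine Finset.sum_lt_sum (fun z hz => hm z (Finset.mem_filter.1 hz).1) ⟨y, Finset.mem_filter.2 ⟨hy, xy⟩, ?_⟩
    have := hm y hy
    omega
  rw [Finset.sum_const, smul_eq_mul] at hlt
  have : (S.filter (fun z => G.Adj x z)).card = 6 := hx6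
  omega

theorem six12 (h : G5 G) (S : Finset V) (hc : S.card = 25) (he : es G S = 114) (hm : ∀ x ∈ S, 4 ≤ dg G S x) (x : V) (hx : x ∈ S) (hx6 : dg G S x = 6) :
    (cl G S 6).card = 1 ∨ (cl G S 6).card = 2 := by
  have h6 := six4 h S hc hm
  have hS : ∀ x ∈ S, dg G S x = 6 ∨ dg G S x = 5 ∨ dg G S x = 4 := by
    intro x hx
    have := ball h S x hx 4 hm
    have := hm x hx
    omega
  have spl : ∀ f : V → ℕ, ∑ x ∈ S, f x = ∑ x ∈ cl G S 6, f x + ∑ x ∈ cl G S 5, f x + ∑ x ∈ cl G S 4, f x := by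
    intro f
    unfold cl
    simp only [Finset.sum_filter]
    rw [← Finset.sum_add_distrib, ← Finset.sum_add_distrib]
    apply Finset.sum_congr rfl
    intro x hx
    rcases hS x hx with e | e | e <;> simp [e]
  have cnt : S.card = (cl G S 6).card + (cl G S 5).card + (cl G S 4).card := by simpa using spl (fun _ => 1)
  have esum : es G S = 6 * (cl G S 6).card + 5 * (cl G S 5).card + 4 * (cl G S 4).card := by
    rw [← sum_cl, ← sum_cl, ← sum_cl]; exact spl _
  have z : ∀ x ∈ S, dg G S x ≠ 4 → dg G (cl G S 6) x = 0 := by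
    intro x hx hx4
    by_contra hne
    obtain ⟨y, hy, xy⟩ := nb1 (Nat.one_le_iff_ne_zero.2 hne)
    exact hx4 (h6 y (mem_cl.1 hy).1 (mem_cl.1 hy).2 x hx xy.symm)
  have z6 : ∑ x ∈ cl G S 6, dg G (cl G S 6) x = 0 := Finset.sum_eq_zero (fun x hx => z x (mem_cl.1 hx).1 (by rw [(mem_cl.1 hx).2]; norm_num))
  have z5 : ∑ x ∈ cl G S 5, dg G (cl G S 6) x = 0 := Finset.sum_eq_zero (fun x hx => z x (mem_cl.1 hx).1 (by rw [(mem_cl.1 hx).2]; norm_num))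
  have h1 := pair_lemma h S (cl G S 6)
  have h2 := dg_dc G S (cl G S 6)
  rw [sum_cl] at h2
  have h3 := spl (dg G (cl G S 6))
  have h4 := spl (fun x => dg G (cl G S 6) x * dg G (cl G S 6) x)
  have hq := sum_sq (cl G S 4) (dg G (cl G S 6)) 3 2 (fun x _ => q_aux _ 1)
  have hpos : 0 < (cl G S 6).card := Finset.card_pos.2 ⟨x, mem_cl.2 ⟨hx, hx6⟩⟩
  have hle : (cl G S 6).card ≤ 7 := by omega
  generalize (cl G S 6).card = s at *
  interval_cases s <;> omega
end
end TS

namespace TS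
theorem g5_of (G : SimpleGraph (Fin 25)) (hg : GirthAtLeast5 G) : G5 G := by
  constructor
  · intro a b d ab bd ad
    have hc : (SimpleGraph.Walk.cons ab (SimpleGraph.Walk.cons bd (SimpleGraph.Walk.cons ad.symm SimpleGraph.Walk.nil))).IsCycle := by
      rw [SimpleGraph.Walk.cons_isCycle_iff]
      simp [SimpleGraph.Walk.isPath_def, ab.ne, ab.ne', bd.ne, bd.ne', ad.ne, ad.ne']
    have := hg _ hc
    simp at this
  · intro a b d e ab bd de ea
    by_contra hno
    push Not at hno
    have hc : (SimpleGraph.Walk.cons ab (SimpleGraph.Walk.cons bd (SimpleGraph.Walk.cons de (SimpleGraph.Walk.cons ea SimpleGraph.Walk.nil)))).IsCycle := by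
      rw [SimpleGraph.Walk.cons_isCycle_iff]
      simp [SimpleGraph.Walk.isPath_def, ab.ne, ab.ne', bd.ne, bd.ne', de.ne, de.ne', ea.ne, ea.ne', hno.1, hno.2, hno.1.symm, hno.2.symm]
    have := hg _ hc
    simp at this

theorem dg_univ (G : SimpleGraph (Fin 25)) [DecidableRel G.Adj] (x : Fin 25) : dg G Finset.univ x = G.degree x := by
  unfold dg
  rw [← SimpleGraph.card_neighborFinset_eq_degree, SimpleGraph.neighborFinset_eq_filter]

theorem star_of (G : SimpleGraph (Fin 25)) [DecidableRel G.Adj] (h : St G Finset.univ) : HasEmbeddedStar G 5 ![4, 4, 4, 3, 3] := by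
  obtain ⟨x, -, hx5, hx3, hx4⟩ := h
  obtain ⟨a, ha, b, hb, c, hc, hab, hac, hbc, xa, xb, xc⟩ := nb3 hx3
  have e1 := dg_erase G Finset.univ a x (Finset.mem_univ _)
  have e2 := dg_erase G (Finset.univ.erase a) b x (by simp [hab.symm])
  have e3 := dg_erase G ((Finset.univ.erase a).erase b) c x (by simp [hac.symm, hbc.symm])
  rw [if_pos xa] at e1
  rw [if_pos xb] at e2
  rw [if_pos xc] at e3
  obtain ⟨d, hd, e, he, hde, xd, xe⟩ := nb2 (show 2 ≤ dg G (((Finset.univ.erase a).erase b).erase c) x by omega)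
  simp only [Finset.mem_erase, Finset.mem_univ, and_true] at hd he
  have ga := (mem_cl.1 ha).2
  have gb := (mem_cl.1 hb).2
  have gc := (mem_cl.1 hc).2
  have gd := hx4 d (Finset.mem_univ _) xd
  have ge := hx4 e (Finset.mem_univ _) xe
  rw [dg_univ] at ga gb gc gd ge hx5
  refine ⟨x, ![a, b, c, d, e], hx5, ?_, ?_, ?_⟩
  · rw [← List.nodup_ofFn]
    simp [List.ofFn_succ, hab, hac, hbc, hde, hd.1, hd.2.1, hd.2.2, he.1, he.2.1, he.2.2, Ne.symm hd.1, Ne.symm hd.2.1, Ne.symm hd.2.2, Ne.symm he.1, Ne.symm he.2.1, Ne.symm he.2.2]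
  · intro i; fin_cases i <;> simp <;> assumption
  · intro i; fin_cases i
    exacts [ga.ge, gb.ge, gc.ge, gd, ge]

theorem star6_of (G : SimpleGraph (Fin 25)) [DecidableRel G.Adj] (x : Fin 25) (hx : G.degree x = 6) (h4 : ∀ y, 4 ≤ G.degree y) :
    HasEmbeddedStar G 6 ![3, 3, 3, 3, 3, 3] := by
  have hcard : (G.neighborFinset x).card = 6 := hx
  refine ⟨x, fun i => (G.neighborFinset x).orderEmbOfFin hcard i, hx, ?_, ?_, ?_⟩
  · exact ((G.neighborFinset x).orderEmbOfFin hcard).injective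
  · intro i
    have := Finset.orderEmbOfFin_mem (G.neighborFinset x) hcard i
    exact (G.mem_neighborFinset x _).1 this
  · intro i
    have := h4 ((G.neighborFinset x).orderEmbOfFin hcard i)
    fin_cases i <;> simpa using this
end TS

theorem stmt12 (G : SimpleGraph (Fin 25)) [DecidableRel G.Adj]
    (hg : GirthAtLeast5 G) (he : G.edgeFinset.card = 57) :
    ((G.minDegree, G.maxDegree) = (3, 5) ∨ (G.minDegree, G.maxDegree) = (4, 5) ∨
      (G.minDegree, G.maxDegree) = (4, 6)) ∧
    (((G.minDegree, G.maxDegree) = (3, 5) ∨ (G.minDegree, G.maxDegree) = (4, 5)) →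
      (HasEmbeddedStar G 5 ![4, 4, 4, 4, 3] ∨ HasEmbeddedStar G 5 ![4, 4, 4, 3, 3])) ∧
    ((G.minDegree, G.maxDegree) = (4, 6) →
      (degCount G 6 = 1 ∨ degCount G 6 = 2) ∧
      HasEmbeddedStar G 6 ![3, 3, 3, 3, 3, 3]) := by
  have h := TS.g5_of G hg
  have hc : (Finset.univ : Finset (Fin 25)).card = 25 := by simp
  have hes : TS.es G Finset.univ = 114 := by
    unfold TS.es
    rw [Finset.sum_congr rfl (fun x _ => TS.dg_univ G x), G.sum_degrees_eq_twice_card_edges, he]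
  obtain ⟨u, hu⟩ := G.exists_minimal_degree_vertex
  obtain ⟨w, hw⟩ := G.exists_maximal_degree_vertex
  have hmin : ∀ x, G.minDegree ≤ G.degree x := G.minDegree_le_degree
  have hmax : ∀ x, G.degree x ≤ G.maxDegree := G.degree_le_maxDegree
  have m3 : 3 ≤ G.minDegree := by
    have := TS.min3 h _ hc hes u (Finset.mem_univ _)
    rw [TS.dg_univ] at this; omega
  have M5 : 5 ≤ G.maxDegree := by
    obtain ⟨x, -, hx⟩ := TS.ex_big Finset.univ (TS.dg G Finset.univ) 4 (by rw [hc]; unfold TS.es at hes; omega)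
    rw [TS.dg_univ] at hx
    have := hmax x
    omega
  have m4 : G.minDegree ≤ 4 := by
    by_contra hlt
    have := TS.es_ge (G := G) Finset.univ 5 (fun x _ => by rw [TS.dg_univ]; have := hmin x; omega)
    rw [hc] at this
    omega
  have A : G.minDegree = 3 → G.maxDegree = 5 ∧ TS.St G Finset.univ := by
    intro hm
    have hu3 : TS.dg G Finset.univ u = 3 := by rw [TS.dg_univ]; omega
    have h1 := TS.max35 h _ hc hes u (Finset.mem_univ _) hu3 w (Finset.mem_univ _)
    rw [TS.dg_univ] at h1
    exact ⟨by omega, TS.star35 h _ hc hes u (Finset.mem_univ _) hu3⟩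
  have B : G.minDegree = 4 → ∀ x ∈ (Finset.univ : Finset (Fin 25)), 4 ≤ TS.dg G Finset.univ x := by
    intro hm x _
    rw [TS.dg_univ]; have := hmin x; omega
  have C : G.minDegree = 4 → G.maxDegree ≤ 6 := by
    intro hm
    have := TS.ball h _ w (Finset.mem_univ _) 4 (B hm)
    rw [TS.dg_univ, hc] at this
    omega
  simp only [Prod.mk.injEq]
  refine ⟨?_, ?_, ?_⟩
  · rcases Nat.lt_or_ge G.minDegree 4 with hm | hm
    · have := A (by omega)
      omega
    · have := C (by omega)
      omega
  · rintro (⟨h1, h2⟩ | ⟨h1, h2⟩)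
    · exact Or.inr (TS.star_of G (A h1).2)
    · refine Or.inr (TS.star_of G (TS.star45 h _ hc hes ?_))
      intro x _
      rw [TS.dg_univ]
      have := hmin x
      have := hmax x
      omega
  · rintro ⟨h1, h2⟩
    constructor
    · have := TS.six12 h _ hc hes (B h1) w (Finset.mem_univ _) (by rw [TS.dg_univ]; omega)
      unfold TS.cl at this
      simp only [TS.dg_univ] at this
      exact this
    · exact TS.star6_of G w (by omega) (fun y => by have := hmin y; omega)
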